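/- (γ-theorem) Let ζ ∈ B(ω,R) be a zero of f = (f₁,…,f_n) ∈ A²(ω,R)^n with Df(ζ) invertible; write γ = γ(f,ζ) and κ = κ_ζ. Then for every x ∈ B(ω,R) with u := κ‖x − ζ‖ < (2γ + 1 − √(4γ² + 3γ))/(γ + 1), the Newton sequence x₀ = x, x_{k+1} = N_f(x_k) is well defined (Df(x_k) is invertible for all k) and converges quadratically to ζ; more precisely ‖x_k − ζ‖ ≤ (1/2)^{2^k − 1} ‖x − ζ‖ for all k ≥ 0. -/

import Mathlib

open MeasureTheory Metric

noncomputable section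

/-- `ℂⁿ` with the Euclidean (Hermitian) norm. -/
abbrev En (n : ℕ) := EuclideanSpace ℂ (Fin n)

instance (n : ℕ) : InnerProductSpace ℝ (En n) := InnerProductSpace.rclikeToReal ℂ _
instance (n : ℕ) : MeasurableSpace (En n) := borel _
instance (n : ℕ) : BorelSpace (En n) := ⟨rfl⟩

/-- The `A²(ω,R)` norm: `‖f‖² = (n!/(πⁿ R^{2n})) ∫_{B(ω,R)} ‖f(z)‖² dz`.  For a system
`f = (f₁,…,f_s) : ℂⁿ → ℂˢ` (with `ℂˢ` carrying the Euclidean norm) this is exactly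
`(Σᵢ ‖fᵢ‖²)^{1/2}`. -/
def A2Norm {𝓕 : Type*} [NormedAddCommGroup 𝓕] {n : ℕ} (ω : En n) (R : ℝ)
    (f : En n → 𝓕) : ℝ :=
  Real.sqrt (((n.factorial : ℝ) / (Real.pi ^ n * R ^ (2 * n))) * ∫ z in ball ω R, ‖f z‖ ^ 2)

/-- Membership in `A²(ω,R)`: analytic on the open ball `B(ω,R)` and square integrable there. -/
def MemA2 {𝓕 : Type*} [NormedAddCommGroup 𝓕] [NormedSpace ℂ 𝓕] {n : ℕ}
    (ω : En n) (R : ℝ) (f : En n → 𝓕) : Prop :=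
  AnalyticOnNhd ℂ f (ball ω R) ∧ IntegrableOn (fun z => ‖f z‖ ^ 2) (ball ω R)

lemma integral_norm_pow_mul_exp_neg_norm_sq (k : ℕ) :
    ∫ z : ℂ, ‖z‖ ^ (2 * k) * Real.exp (-‖z‖ ^ 2) = Real.pi * k.factorial := by
  have h := Complex.integral_rpow_mul_exp_neg_rpow (p := 2) (q := (2 * k : ℕ)) (by norm_num)
    (by have : (0 : ℝ) ≤ ((2 * k : ℕ) : ℝ) := Nat.cast_nonneg _
        linarith)
  simp only [Real.rpow_natCast, Real.rpow_two] at h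
  rw [h]
  have : (((2 * k : ℕ) : ℝ) + 2) / 2 = k + 1 := by push_cast; ring
  rw [this, Real.Gamma_nat_eq_factorial]
  ring

lemma integral_pi_gaussian_moment (n k : ℕ) (i₀ : Fin n) :
    ∫ x : Fin n → ℂ, ‖x i₀‖ ^ (2 * k) * Real.exp (-∑ i, ‖x i‖ ^ 2)
      = Real.pi ^ n * k.factorial := by
  have h := integral_fintype_prod_volume_eq_prod (𝕜 := ℝ) (ι := Fin n) (E := fun _ => ℂ)
    (fun i z => ‖z‖ ^ (2 * (if i = i₀ then k else 0)) * Real.exp (-‖z‖ ^ 2))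
  simp only [integral_norm_pow_mul_exp_neg_norm_sq, Finset.prod_mul_distrib,
    Finset.prod_const, Finset.card_univ, Fintype.card_fin] at h
  have e1 : ∏ i : Fin n, (((if i = i₀ then k else 0 : ℕ).factorial : ℕ) : ℝ) = k.factorial := by
    rw [Finset.prod_eq_single i₀] <;> simp +contextual
  rw [e1] at h
  rw [← h]
  congr 1
  ext x
  rw [← Finset.sum_neg_distrib, Real.exp_sum]
  congr 1
  rw [Finset.prod_eq_single i₀] <;> simp +contextual

lemma integral_coord_gaussian_moment (n k : ℕ) (i₀ : Fin n) :
    ∫ w : En n, ‖w i₀‖ ^ (2 * k) * Real.exp (-‖w‖ ^ 2) = Real.pi ^ n * k.factorial := by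
  let e : En n ≃L[ℝ] (Fin n → ℂ) := PiLp.continuousLinearEquiv 2 ℝ (fun _ : Fin n => ℂ)
  have hμ : (Measure.map e volume : Measure (Fin n → ℂ)).IsAddHaarMeasure :=
    e.isAddHaarMeasure_map volume
  obtain ⟨c, hc⟩ : ∃ c : NNReal, (Measure.map e volume : Measure (Fin n → ℂ)) = c • volume :=
    ⟨_, Measure.isAddLeftInvariant_eq_smul _ _⟩
  have key : ∀ j : ℕ, ∫ w : En n, ‖w i₀‖ ^ (2 * j) * Real.exp (-‖w‖ ^ 2)
      = c * (Real.pi ^ n * j.factorial) := by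
    intro j
    have h1 : ∫ x, (‖x i₀‖ ^ (2 * j) * Real.exp (-∑ i, ‖x i‖ ^ 2))
        ∂(Measure.map e volume : Measure (Fin n → ℂ)) =
        ∫ w : En n, ‖w i₀‖ ^ (2 * j) * Real.exp (-‖w‖ ^ 2) := by
      rw [integral_map e.continuous.aemeasurable]
      · congr 1
        ext w
        rw [EuclideanSpace.norm_sq_eq]
        rfl
      · apply Continuous.aestronglyMeasurable
        fun_prop
    rw [← h1, hc, integral_smul_nnreal_measure, integral_pi_gaussian_moment, NNReal.smul_def,
      smul_eq_mul]
  have h0 := key 0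
  have hg := GaussianFourier.integral_rexp_neg_mul_sq_norm (V := En n) (b := 1) one_pos
  have hd : Module.finrank ℝ (En n) = 2 * n := by
    rw [finrank_real_of_complex]; simp
  rw [hd] at hg
  have : ((2 * n : ℕ) : ℝ) / 2 = n := by push_cast; ring
  simp only [this, div_one, Real.rpow_natCast] at hg
  simp only [mul_zero, pow_zero, one_mul, Nat.factorial_zero, Nat.cast_one, mul_one] at h0
  simp only [neg_mul, one_mul] at hg
  rw [hg] at h0
  have hc1 : (c : ℝ) = 1 := by
    have : (Real.pi ^ n : ℝ) ≠ 0 := by positivity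
    field_simp at h0
    exact h0.symm
  rw [key k, hc1, one_mul]

lemma LinearIsometryEquiv.measurePreserving_complex {n : ℕ} (U : En n ≃ₗᵢ[ℂ] En n) :
    MeasurePreserving U volume volume :=
  LinearIsometryEquiv.measurePreserving
    (⟨U.toLinearEquiv.restrictScalars ℝ, U.norm_map⟩ : En n ≃ₗᵢ[ℝ] En n)

lemma integral_gaussian_moment {n : ℕ} (k : ℕ) (y : En n) (hy : ‖y‖ = 1) :
    ∫ w : En n, ‖inner ℂ y w‖ ^ (2 * k) * Real.exp (-‖w‖ ^ 2) = Real.pi ^ n * k.factorial := by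
  have hn : 0 < n := by
    rcases Nat.eq_zero_or_pos n with h | h
    · subst h
      rw [Subsingleton.elim y 0] at hy
      simp at hy
    · exact h
  let i₀ : Fin n := ⟨0, hn⟩
  obtain ⟨b, hb⟩ := Orthonormal.exists_orthonormalBasis_extension_of_card_eq (𝕜 := ℂ)
    (E := En n) (ι := Fin n) (by simp) (v := fun _ => y) (s := {i₀})
    (by
      constructor
      · intro i; simpa using hy
      · intro i j hij
        exact absurd (Subsingleton.elim i j) hij)
  have hb0 : b i₀ = y := hb i₀ rfl
  rw [← integral_coord_gaussian_moment n k i₀]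
  have := (LinearIsometryEquiv.measurePreserving_complex b.repr).integral_comp'
    (f := b.repr.toHomeomorph.toMeasurableEquiv)
    (fun w => ‖w i₀‖ ^ (2 * k) * Real.exp (-‖w‖ ^ 2))
  rw [← this]
  congr 1
  ext w
  change _ = ‖b.repr w i₀‖ ^ (2 * k) * Real.exp (-‖b.repr w‖ ^ 2)
  rw [b.repr_apply_apply, hb0, b.repr.norm_map]

lemma setIntegral_ball_homogeneous {n k : ℕ} {g : En n → ℝ}
    (hg : ∀ (r : ℝ) (w : En n), 0 < r → g (r • w) = r ^ (2 * k) * g w) {r : ℝ} (hr : 0 < r) :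
    ∫ w in ball (0 : En n) r, g w = r ^ (2 * (n + k)) * ∫ w in ball (0 : En n) 1, g w := by
  have h := Measure.setIntegral_comp_smul_of_pos (volume : Measure (En n)) g
    (ball (0 : En n) 1) hr
  have hd : Module.finrank ℝ (En n) = 2 * n := by
    rw [finrank_real_of_complex]; simp
  rw [hd, smul_unitBall_of_pos hr] at h
  simp only [hg r _ hr, integral_const_mul, smul_eq_mul] at h
  have : r ^ (2 * n) ≠ 0 := by positivity
  field_simp at h
  rw [← h]; ring

/-- Moments of a unit linear functional over the unit ball of `ℂⁿ`. -/
lemma setIntegral_ball_moment {n : ℕ} (k : ℕ) (y : En n) (hy : ‖y‖ = 1) :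
    ∫ w in ball (0 : En n) 1, ‖inner ℂ y w‖ ^ (2 * k)
      = Real.pi ^ n * k.factorial / (n + k).factorial := by
  set g : En n → ℝ := fun w => ‖inner ℂ y w‖ ^ (2 * k) with hgdef
  have hgc : Continuous g := by fun_prop
  have hg : ∀ (r : ℝ) (w : En n), 0 < r → g (r • w) = r ^ (2 * k) * g w := by
    intro r w hr
    have : (r • w : En n) = (r : ℂ) • w := by
      ext i; simp
    simp only [hgdef, this, inner_smul_right, norm_mul, mul_pow, Complex.norm_real,
      Real.norm_eq_abs, abs_of_pos hr]
  set M := ∫ w in ball (0 : En n) 1, g w with hM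
  let h : En n × ℝ → ℝ := fun p => {p : En n × ℝ | ‖p.1‖ ^ 2 < p.2}.indicator
    (fun p => g p.1 * Real.exp (-p.2)) p
  have hmeas : Measurable h := by
    apply Measurable.indicator
    · exact (Continuous.measurable (by fun_prop))
    · exact (isOpen_lt (by fun_prop) (by fun_prop)).measurableSet
  have hslice : ∀ s ∈ Set.Ioi (0 : ℝ), (fun w => h (w, s)) =
      (ball (0 : En n) (Real.sqrt s)).indicator (fun w => g w * Real.exp (-s)) := by
    intro s hs
    ext w
    simp only [h, Set.indicator, Set.mem_ofPred_eq, mem_ball_zero_iff]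
    have : ‖w‖ ^ 2 < s ↔ ‖w‖ < Real.sqrt s := (Real.lt_sqrt (norm_nonneg _)).symm
    simp [this]
  have hgi : ∀ r : ℝ, IntegrableOn g (ball (0 : En n) r) := fun r =>
    (hgc.continuousOn.integrableOn_compact (isCompact_closedBall 0 r)).mono_set
      ball_subset_closedBall
  have hint : ∀ s ∈ Set.Ioi (0 : ℝ), ∫ w, h (w, s) = M * (Real.exp (-s) * s ^ (n + k)) := by
    intro s hs
    rw [hslice s hs, integral_indicator measurableSet_ball, integral_mul_const,
      setIntegral_ball_homogeneous hg (Real.sqrt_pos.2 hs), pow_mul, Real.sq_sqrt (le_of_lt hs)]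
    ring
  have hnn : ∀ p, 0 ≤ h p := fun p => Set.indicator_nonneg (fun p _ => by positivity) p
  have hGam := Real.GammaIntegral_convergent (s := (n + k : ℕ) + 1) (by positivity)
  simp only [add_sub_cancel_right, Real.rpow_natCast] at hGam
  have hI : Integrable h ((volume : Measure (En n)).prod (volume.restrict (Set.Ioi (0 : ℝ)))) := by
    rw [integrable_prod_iff' hmeas.aestronglyMeasurable]
    constructor
    · filter_upwards [ae_restrict_mem measurableSet_Ioi] with s hs
      rw [hslice s hs, integrable_indicator_iff measurableSet_ball]
      exact (hgi _).mul_const _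
    · simp only [Real.norm_of_nonneg (hnn _)]
      refine IntegrableOn.congr_fun (f := fun s => M * (Real.exp (-s) * s ^ (n + k)))
        (hGam.const_mul M) (fun s hs => (hint s hs).symm) measurableSet_Ioi
  have hswap := integral_integral_swap (f := fun w s => h (w, s)) hI
  have hL : ∫ w, ∫ s in Set.Ioi (0 : ℝ), h (w, s) = Real.pi ^ n * k.factorial := by
    rw [← integral_gaussian_moment k y hy]
    congr 1
    ext w
    have : (fun s => h (w, s)) = (Set.Ioi (‖w‖ ^ 2)).indicator (fun s => g w * Real.exp (-s)) := by
      ext s; simp [h, Set.indicator]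
    rw [this, setIntegral_indicator measurableSet_Ioi, Set.Ioi_inter_Ioi,
      sup_of_le_right (by positivity), integral_const_mul, integral_exp_neg_Ioi]
  have hR : ∫ s in Set.Ioi (0 : ℝ), ∫ w, h (w, s) = M * (n + k).factorial := by
    rw [setIntegral_congr_fun measurableSet_Ioi hint, integral_const_mul,
      ← Real.Gamma_nat_eq_factorial, Real.Gamma_eq_integral (by positivity)]
    simp only [add_sub_cancel_right, Real.rpow_natCast]
  rw [hL, hR] at hswap
  rw [hswap]
  field_simp

lemma LinearIsometryEquiv.setIntegral_ball_comp {n : ℕ} (U : En n ≃ₗᵢ[ℂ] En n) (r : ℝ)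
    (H : En n → ℂ) :
    ∫ w in ball (0 : En n) r, H (U w) = ∫ w in ball (0 : En n) r, H w := by
  have h := (LinearIsometryEquiv.measurePreserving_complex U).setIntegral_preimage_emb
    U.toHomeomorph.measurableEmbedding H (ball 0 r)
  rw [← h]
  congr 2
  ext w
  simp

/-- The unitary map `w ↦ c w`, for `‖c‖ = 1`. -/
def unitScale (n : ℕ) (c : ℂ) (hc : ‖c‖ = 1) : En n ≃ₗᵢ[ℂ] En n where
  toLinearEquiv := LinearEquiv.smulOfNeZero ℂ (En n) c (by rintro rfl; simp at hc)
  norm_map' w := by simp [norm_smul, hc]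

lemma setIntegral_ball_eq_zero_of_homogeneous {n j k : ℕ} (hjk : j ≠ k) {H : En n → ℂ}
    (hH : ∀ (c : ℂ) (w : En n), ‖c‖ = 1 → H (c • w) = c ^ j * (starRingEnd ℂ c) ^ k * H w)
    (r : ℝ) : ∫ w in ball (0 : En n) r, H w = 0 := by
  set d : ℝ := Real.pi / ((j : ℝ) - k) with hd
  set c : ℂ := Complex.exp (d * Complex.I) with hcdef
  have hc : ‖c‖ = 1 := Complex.norm_exp_ofReal_mul_I d
  have hjk' : ((j : ℂ) - k) ≠ 0 := sub_ne_zero.2 (by exact_mod_cast hjk)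
  have hm : c ^ j * (starRingEnd ℂ c) ^ k = -1 := by
    rw [hcdef, ← Complex.exp_conj, ← Complex.exp_nat_mul, ← Complex.exp_nat_mul,
      ← Complex.exp_add, ← Complex.exp_pi_mul_I]
    congr 1
    simp only [map_mul, Complex.conj_ofReal, Complex.conj_I, hd]
    push_cast
    field_simp
    ring
  have h := LinearIsometryEquiv.setIntegral_ball_comp (unitScale n c hc) r H
  have h2 : ∀ w, H (unitScale n c hc w) = -1 * H w := by
    intro w
    change H (c • w) = _
    rw [hH c w hc, hm]
  simp only [h2, integral_const_mul] at h
  linear_combination (-1 / 2 : ℂ) * h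

lemma norm_sq_axis_rotation {n : ℕ} {y : En n} (hy : ‖y‖ = 1) (t : ℂ) (w : En n) :
    ‖inner ℂ y w • y + t • (w - inner ℂ y w • y)‖ ^ 2
      = ‖(inner ℂ y w : ℂ)‖ ^ 2 + ‖t‖ ^ 2 * ‖w - inner ℂ y w • y‖ ^ 2 := by
  have h0 : inner ℂ y (w - inner ℂ y w • y) = (0 : ℂ) := by
    rw [inner_sub_right, inner_smul_right, inner_self_eq_norm_sq_to_K, hy]; simp
  have := norm_add_sq_eq_norm_sq_add_norm_sq_of_inner_eq_zero (𝕜 := ℂ) (inner ℂ y w • y)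
    (t • (w - inner ℂ y w • y)) (by rw [inner_smul_left, inner_smul_right, h0]; simp)
  simp only [← pow_two, norm_smul, hy, mul_one, mul_pow] at this
  rw [this]

lemma norm_axis_rotation_le {n : ℕ} {y : En n} (hy : ‖y‖ = 1) {t : ℂ} (ht : ‖t‖ ≤ 1) (w : En n) :
    ‖inner ℂ y w • y + t • (w - inner ℂ y w • y)‖ ≤ ‖w‖ := by
  have h1 := norm_sq_axis_rotation hy t w
  have h2 := norm_sq_axis_rotation hy 1 w
  simp only [one_smul, add_sub_cancel, norm_one, one_pow, one_mul] at h2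
  have : ‖t‖ ^ 2 ≤ 1 := pow_le_one₀ (norm_nonneg _) ht
  refine (sq_le_sq₀ (norm_nonneg _) (norm_nonneg _)).1 ?_
  rw [h1, h2]
  nlinarith [sq_nonneg ‖w - inner ℂ y w • y‖]

/-- The unitary map fixing `y` and multiplying its orthogonal complement by `c`. -/
def axisRotation {n : ℕ} (y : En n) (hy : ‖y‖ = 1) (c : ℂ) (hc : ‖c‖ = 1) :
    En n ≃ₗᵢ[ℂ] En n :=
  LinearIsometry.toLinearIsometryEquiv
    { toLinearMap :=
        (innerSL ℂ y : En n →ₗ[ℂ] ℂ).smulRight y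
          + c • (LinearMap.id - (innerSL ℂ y : En n →ₗ[ℂ] ℂ).smulRight y)
      norm_map' := by
        intro w
        change ‖inner ℂ y w • y + c • (w - inner ℂ y w • y)‖ = ‖w‖
        have h1 := norm_sq_axis_rotation hy c w
        have h2 := norm_sq_axis_rotation hy 1 w
        simp only [one_smul, add_sub_cancel, norm_one, one_pow, one_mul] at h2
        rw [hc, one_pow, one_mul, ← h2] at h1
        exact (sq_eq_sq₀ (norm_nonneg _) (norm_nonneg _)).1 h1 } rfl

lemma axisRotation_apply {n : ℕ} (y : En n) (hy : ‖y‖ = 1) (c : ℂ) (hc : ‖c‖ = 1) (w : En n) :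
    axisRotation y hy c hc w = inner ℂ y w • y + c • (w - inner ℂ y w • y) := rfl

lemma setIntegral_ball_eq_slice {n : ℕ} {F : En n → ℂ}
    (hF : DifferentiableOn ℂ F (ball 0 1)) {y : En n} (hy : ‖y‖ = 1) (k : ℕ) {r : ℝ}
    (hr : r < 1) :
    ∫ w in ball (0 : En n) r, F w * (inner ℂ w y) ^ k
      = ∫ w in ball (0 : En n) r, F ((inner ℂ y w : ℂ) • y) * (inner ℂ w y) ^ k := by
  let Φ : En n → ℝ → ℂ := fun w θ =>
    F (inner ℂ y w • y + circleMap 0 1 θ • (w - inner ℂ y w • y)) * (inner ℂ w y) ^ k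
  have hcm : ∀ θ, ‖circleMap 0 1 θ‖ = 1 := by intro θ; simp
  have hinner : ∀ (c : ℂ) (w : En n),
      (inner ℂ (inner ℂ y w • y + c • (w - inner ℂ y w • y)) y : ℂ) = inner ℂ w y := by
    intro c w
    simp only [inner_add_left, inner_smul_left, inner_sub_left, inner_self_eq_norm_sq_to_K, hy]
    simp [inner_conj_symm]
  have h1 : ∀ θ, ∫ w in ball (0 : En n) r, Φ w θ
      = ∫ w in ball (0 : En n) r, F w * (inner ℂ w y) ^ k := by
    intro θ
    rw [← LinearIsometryEquiv.setIntegral_ball_comp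
      (axisRotation y hy (circleMap 0 1 θ) (hcm θ)) r (fun w => F w * (inner ℂ w y) ^ k)]
    simp only [axisRotation_apply, hinner, Φ]
  have h2 : ∀ w ∈ ball (0 : En n) r, ∫ θ in Set.Ioc 0 (2 * Real.pi), Φ w θ
      = (2 * Real.pi : ℝ) • (F ((inner ℂ y w : ℂ) • y) * (inner ℂ w y) ^ k) := by
    intro w hw
    have hw' : ‖w‖ < 1 := (mem_ball_zero_iff.1 hw).trans hr
    have hd : DiffContOnCl ℂ (fun t : ℂ => F (inner ℂ y w • y + t • (w - inner ℂ y w • y)))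
        (ball 0 |1|) := by
      apply DifferentiableOn.diffContOnCl
      rw [abs_one, closure_ball _ one_ne_zero]
      apply hF.comp (t := ball 0 1)
      · exact Differentiable.differentiableOn (by fun_prop)
      · intro t ht
        rw [mem_ball_zero_iff]
        exact (norm_axis_rotation_le hy (mem_closedBall_zero_iff.1 ht) w).trans_lt hw'
    have := hd.circleAverage
    rw [Real.circleAverage_def, zero_smul, add_zero,
      intervalIntegral.integral_of_le Real.two_pi_pos.le] at this
    simp only [Φ]
    rw [integral_mul_const, ← this, smul_mul_assoc, smul_smul,
      mul_inv_cancel₀ Real.two_pi_pos.ne', one_smul]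
  have hcont : ContinuousOn (Function.uncurry Φ)
      (closedBall (0 : En n) r ×ˢ Set.Icc 0 (2 * Real.pi)) := by
    apply ContinuousOn.mul
    · apply hF.continuousOn.comp
      · apply Continuous.continuousOn
        have : Continuous (circleMap 0 1) := continuous_circleMap 0 1
        fun_prop
      · rintro ⟨w, θ⟩ ⟨hw, -⟩
        rw [mem_ball_zero_iff]
        exact (norm_axis_rotation_le hy (hcm θ).le w).trans_lt
          ((mem_closedBall_zero_iff.1 hw).trans_lt hr)
    · exact Continuous.continuousOn (by fun_prop)
  have hint : Integrable (Function.uncurry Φ)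
      ((volume.restrict (ball (0 : En n) r)).prod
        (volume.restrict (Set.Ioc 0 (2 * Real.pi)))) := by
    rw [Measure.prod_restrict]
    exact (hcont.integrableOn_compact ((isCompact_closedBall _ _).prod isCompact_Icc)).mono_set
      (Set.prod_mono ball_subset_closedBall Set.Ioc_subset_Icc_self)
  have hswap := integral_integral_swap hint
  rw [setIntegral_congr_fun measurableSet_ball h2, integral_smul] at hswap
  simp only [h1] at hswap
  rw [setIntegral_const, Real.volume_real_Ioc_of_le Real.two_pi_pos.le, sub_zero] at hswap
  exact (smul_right_injective ℂ Real.two_pi_pos.ne' hswap).symm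

lemma inner_mul_inner_comm_pow {n : ℕ} (y w : En n) (k : ℕ) :
    (inner ℂ y w : ℂ) ^ k * (inner ℂ w y) ^ k = ((‖(inner ℂ y w : ℂ)‖ ^ (2 * k) : ℝ) : ℂ) := by
  rw [← mul_pow, ← inner_conj_symm w y, Complex.mul_conj, Complex.normSq_eq_norm_sq, pow_mul]
  push_cast; rfl

lemma setIntegral_ball_mul_inner_pow_of_lt {n : ℕ} {F : En n → ℂ}
    (hF : DifferentiableOn ℂ F (ball 0 1)) {y : En n} (hy : ‖y‖ = 1) {G : ℕ → ℂ}
    (hG : ∀ t : ℂ, ‖t‖ < 1 → HasSum (fun j => G j * t ^ j) (F (t • y))) (k : ℕ) {r : ℝ}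
    (hr0 : 0 < r) (hr : r < 1) :
    ∫ w in ball (0 : En n) r, F w * (inner ℂ w y) ^ k
      = G k * ((∫ w in ball (0 : En n) r, ‖(inner ℂ y w : ℂ)‖ ^ (2 * k) : ℝ) : ℂ) := by
  rw [setIntegral_ball_eq_slice hF hy k hr]
  have hb : ∀ w ∈ ball (0 : En n) r, ‖(inner ℂ y w : ℂ)‖ ≤ r := fun w hw =>
    (norm_inner_le_norm y w).trans (by rw [hy, one_mul]; exact (mem_ball_zero_iff.1 hw).le)
  have hb' : ∀ w ∈ ball (0 : En n) r, ‖(inner ℂ w y : ℂ)‖ ≤ r := fun w hw => by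
    rw [norm_inner_symm]; exact hb w hw
  let T : ℕ → En n → ℂ := fun j w => G j * (inner ℂ y w) ^ j * (inner ℂ w y) ^ k
  have hTc : ∀ j, Continuous (T j) := fun j => by fun_prop
  have hTi : ∀ j, IntegrableOn (T j) (ball (0 : En n) r) := fun j =>
    ((hTc j).continuousOn.integrableOn_compact (isCompact_closedBall 0 r)).mono_set
      ball_subset_closedBall
  have hsum : Summable fun j => ‖G j‖ * r ^ j := by
    have := (hG r (by rw [Complex.norm_real, Real.norm_of_nonneg hr0.le]; exact hr)).summable.norm
    simpa [abs_of_pos hr0] using this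
  have hS : Summable fun j => ∫ w in ball (0 : En n) r, ‖T j w‖ := by
    refine Summable.of_nonneg_of_le (fun j => integral_nonneg fun w => norm_nonneg _) (fun j => ?_)
      ((hsum.mul_right (r ^ k)).mul_right (volume.real (ball (0 : En n) r)))
    have : ∫ w in ball (0 : En n) r, ‖T j w‖
        ≤ ∫ w in ball (0 : En n) r, ‖G j‖ * r ^ j * r ^ k := by
      apply setIntegral_mono_on (hTi j).norm _ measurableSet_ball
      · intro w hw
        simp only [T, norm_mul, norm_pow]
        have := hb w hw
        have := hb' w hw
        gcongr
      · exact integrableOn_const measure_ball_lt_top.ne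
    refine this.trans (le_of_eq ?_)
    rw [setIntegral_const, smul_eq_mul, mul_comm]
  have h := hasSum_integral_of_summable_integral_norm hTi hS
  have hlhs : ∫ w in ball (0 : En n) r, ∑' j, T j w
      = ∫ w in ball (0 : En n) r, F ((inner ℂ y w : ℂ) • y) * (inner ℂ w y) ^ k := by
    apply setIntegral_congr_fun measurableSet_ball
    intro w hw
    exact ((hG (inner ℂ y w) ((hb w hw).trans_lt hr)).mul_right _).tsum_eq
  rw [hlhs] at h
  have hk := hasSum_single (f := fun j => ∫ w in ball (0 : En n) r, T j w) k (by
    intro j hj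
    apply setIntegral_ball_eq_zero_of_homogeneous hj
    intro c w _
    simp only [T, inner_smul_left, inner_smul_right, mul_pow]
    ring)
  rw [h.unique hk, ← integral_complex_ofReal, ← integral_const_mul]
  congr 1
  ext w
  simp only [T]
  rw [mul_assoc, inner_mul_inner_comm_pow]

lemma setIntegral_ball_mul_inner_pow {n : ℕ} {F : En n → ℂ}
    (hF : DifferentiableOn ℂ F (ball 0 1)) (hFi : IntegrableOn F (ball 0 1))
    {y : En n} (hy : ‖y‖ = 1) {G : ℕ → ℂ}
    (hG : ∀ t : ℂ, ‖t‖ < 1 → HasSum (fun j => G j * t ^ j) (F (t • y))) (k : ℕ) :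
    ∫ w in ball (0 : En n) 1, F w * (inner ℂ w y) ^ k
      = G k * ((Real.pi ^ n * k.factorial / (n + k).factorial : ℝ) : ℂ) := by
  rw [← setIntegral_ball_moment k y hy]
  let s : ℕ → Set (En n) := fun m => ball 0 (1 - 1 / ((m : ℝ) + 2))
  have hs : ⋃ m, s m = ball (0 : En n) 1 := by
    ext w
    simp only [s, Set.mem_iUnion, mem_ball_zero_iff]
    constructor
    · rintro ⟨m, hm⟩
      have : 0 < 1 / ((m : ℝ) + 2) := by positivity
      linarith
    · intro hw
      obtain ⟨m, hm⟩ := exists_nat_one_div_lt (sub_pos.2 hw)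
      refine ⟨m, ?_⟩
      have : 1 / ((m : ℝ) + 2) ≤ 1 / ((m : ℝ) + 1) := by gcongr; norm_num
      linarith
  have hmono : Monotone s := by
    intro a b hab
    apply ball_subset_ball
    have : (a : ℝ) ≤ b := by exact_mod_cast hab
    have : 1 / ((b : ℝ) + 2) ≤ 1 / ((a : ℝ) + 2) := by gcongr
    linarith
  have hb : ∀ w ∈ ball (0 : En n) 1, ‖(inner ℂ w y : ℂ)‖ ≤ 1 := fun w hw =>
    (norm_inner_le_norm w y).trans (by rw [hy, mul_one]; exact (mem_ball_zero_iff.1 hw).le)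
  have hi1 : IntegrableOn (fun w => F w * (inner ℂ w y) ^ k) (ball (0 : En n) 1) := by
    apply Integrable.mul_bdd (c := 1) hFi
    · exact Continuous.aestronglyMeasurable (by fun_prop)
    · filter_upwards [ae_restrict_mem measurableSet_ball] with w hw
      rw [norm_pow]
      exact pow_le_one₀ (norm_nonneg _) (hb w hw)
  have hi2 : IntegrableOn (fun w => ‖(inner ℂ y w : ℂ)‖ ^ (2 * k)) (ball (0 : En n) 1) :=
    ((Continuous.continuousOn (by fun_prop)).integrableOn_compact
      (isCompact_closedBall 0 1)).mono_set ball_subset_closedBall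
  have t1 := tendsto_setIntegral_of_monotone (f := fun w => F w * (inner ℂ w y) ^ k)
    (μ := volume) (s := s) (fun m => measurableSet_ball) hmono (by rw [hs]; exact hi1)
  have t2 := tendsto_setIntegral_of_monotone (f := fun w => ‖(inner ℂ y w : ℂ)‖ ^ (2 * k))
    (μ := volume) (s := s) (fun m => measurableSet_ball) hmono (by rw [hs]; exact hi2)
  rw [hs] at t1 t2
  have t3 := ((Complex.continuous_ofReal.tendsto _).comp t2).const_mul (G k)
  refine tendsto_nhds_unique (t1.congr fun m => ?_) t3
  have hm : 1 / ((m : ℝ) + 2) < 1 := by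
    rw [div_lt_one (by positivity)]
    have : (0 : ℝ) ≤ m := m.cast_nonneg
    linarith
  have hm' : 0 < 1 / ((m : ℝ) + 2) := by positivity
  exact setIntegral_ball_mul_inner_pow_of_lt hF hy hG k (by linarith) (by linarith)

lemma exists_unit_smul_eq {n : ℕ} (hn : 0 < n) (z : En n) :
    ∃ y : En n, ‖y‖ = 1 ∧ z = (‖z‖ : ℂ) • y := by
  by_cases hz : z = 0
  · exact ⟨EuclideanSpace.single ⟨0, hn⟩ 1, by simp, by simp [hz]⟩
  · refine ⟨(‖z‖⁻¹ : ℂ) • z, ?_, ?_⟩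
    · have : ‖z‖ ≠ 0 := norm_ne_zero_iff.2 hz
      rw [norm_smul]
      simp [this]
    · rw [smul_smul, mul_inv_cancel₀, one_smul]
      exact_mod_cast norm_ne_zero_iff.2 hz

/-- The reproducing property of the Bergman kernel of the unit ball. -/
theorem bergman_reproducing {n : ℕ} (hn : 0 < n) {F : En n → ℂ}
    (hF : DifferentiableOn ℂ F (ball 0 1)) (hFi : IntegrableOn F (ball 0 1))
    {z : En n} (hz : ‖z‖ < 1) :
    ∫ w in ball (0 : En n) 1, F w * (1 / (1 - inner ℂ w z) ^ (n + 1))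
      = (Real.pi ^ n / n.factorial : ℝ) * F z := by
  obtain ⟨y, hy, hzy⟩ := exists_unit_smul_eq hn z
  set ρ : ℝ := ‖z‖ with hρ
  have hρ0 : 0 ≤ ρ := norm_nonneg z
  let g : ℂ → ℂ := fun t => F (t • y)
  have hg : DifferentiableOn ℂ g (ball 0 1) := by
    apply hF.comp
    · exact Differentiable.differentiableOn (by fun_prop)
    · intro t ht
      rw [mem_ball_zero_iff] at ht ⊢
      rwa [norm_smul, hy, mul_one]
  let G : ℕ → ℂ := fun j => (j.factorial : ℂ)⁻¹ * iteratedDeriv j g 0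
  have hG : ∀ t : ℂ, ‖t‖ < 1 → HasSum (fun j => G j * t ^ j) (F (t • y)) := by
    intro t ht
    refine (Complex.hasSum_taylorSeries_on_ball hg (mem_ball_zero_iff.2 ht)).congr_fun fun j => ?_
    simp only [G, sub_zero, smul_eq_mul]; ring
  have hb : ∀ w ∈ ball (0 : En n) 1, ‖(inner ℂ w y : ℂ)‖ ≤ 1 := fun w hw =>
    (norm_inner_le_norm w y).trans (by rw [hy, mul_one]; exact (mem_ball_zero_iff.1 hw).le)
  let T : ℕ → En n → ℂ := fun j w =>
    ((((j + n).choose n : ℕ) : ℂ) * (ρ : ℂ) ^ j) * (F w * (inner ℂ w y) ^ j)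
  have hTi0 : ∀ j : ℕ, IntegrableOn (fun w => F w * (inner ℂ w y) ^ j) (ball (0 : En n) 1) := by
    intro j
    apply Integrable.mul_bdd (c := 1) hFi
    · exact Continuous.aestronglyMeasurable (by fun_prop)
    · filter_upwards [ae_restrict_mem measurableSet_ball] with w hw
      rw [norm_pow]
      exact pow_le_one₀ (norm_nonneg _) (hb w hw)
  have hTi : ∀ j, IntegrableOn (T j) (ball (0 : En n) 1) := fun j => (hTi0 j).const_mul _
  have hρ1 : ‖ρ‖ < 1 := by rwa [Real.norm_of_nonneg hρ0]
  have hS : Summable fun j => ∫ w in ball (0 : En n) 1, ‖T j w‖ := by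
    refine Summable.of_nonneg_of_le (fun j => integral_nonneg fun w => norm_nonneg _) (fun j => ?_)
      ((hasSum_choose_mul_geometric_of_norm_lt_one n hρ1).summable.mul_right
        (∫ w in ball (0 : En n) 1, ‖F w‖))
    rw [← integral_const_mul]
    apply setIntegral_mono_on (hTi j).norm (hFi.norm.const_mul _) measurableSet_ball
    intro w hw
    simp only [T, norm_mul, norm_pow, Complex.norm_natCast, Complex.norm_real, Real.norm_eq_abs,
      abs_of_nonneg hρ0]
    have : ‖(inner ℂ w y : ℂ)‖ ^ j ≤ 1 := pow_le_one₀ (norm_nonneg _) (hb w hw)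
    have h1 : ‖F w‖ * ‖(inner ℂ w y : ℂ)‖ ^ j ≤ ‖F w‖ :=
      mul_le_of_le_one_right (norm_nonneg _) this
    gcongr
  have h := hasSum_integral_of_summable_integral_norm hTi hS
  have hlhs : ∫ w in ball (0 : En n) 1, ∑' j, T j w
      = ∫ w in ball (0 : En n) 1, F w * (1 / (1 - inner ℂ w z) ^ (n + 1)) := by
    apply setIntegral_congr_fun measurableSet_ball
    intro w hw
    have h1 : ‖(ρ : ℂ) * inner ℂ w y‖ < 1 := by
      rw [norm_mul, Complex.norm_real]
      exact (mul_le_of_le_one_right (norm_nonneg _) (hb w hw)).trans_lt hρ1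
    have h2 := (hasSum_choose_mul_geometric_of_norm_lt_one n h1).mul_left (F w)
    have h3 : (inner ℂ w z : ℂ) = ρ * inner ℂ w y := by rw [hzy, inner_smul_right]
    beta_reduce
    rw [h3, ← h2.tsum_eq]
    congr 1
    ext j
    simp only [T]; ring
  rw [hlhs] at h
  have h4 := (hG ρ (by rw [Complex.norm_real]; exact hρ1)).mul_left
    (((Real.pi ^ n / n.factorial : ℝ)) : ℂ)
  rw [← hzy] at h4
  refine h.unique (h4.congr_fun ?_)
  intro j
  simp only [T]
  rw [integral_const_mul, setIntegral_ball_mul_inner_pow hF hFi hy hG]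
  have hc : (((j + n).choose n : ℕ) : ℂ) * n.factorial * j.factorial = (n + j).factorial := by
    have := Nat.add_choose_mul_factorial_mul_factorial j n
    rw [add_comm n j, ← this]
    push_cast; ring
  push_cast
  rw [← hc]
  have : ((n + j).factorial : ℂ) ≠ 0 := by exact_mod_cast (n + j).factorial_ne_zero
  rw [← hc] at this
  have e1 := left_ne_zero_of_mul this
  have e2 := left_ne_zero_of_mul e1
  have e3 := right_ne_zero_of_mul e1
  have e4 := right_ne_zero_of_mul this
  field_simp

lemma one_sub_norm_le_norm_one_sub_inner {n : ℕ} {w z : En n} (hw : ‖w‖ ≤ 1) :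
    1 - ‖z‖ ≤ ‖1 - (inner ℂ w z : ℂ)‖ := by
  have h1 : ‖(inner ℂ w z : ℂ)‖ ≤ ‖z‖ := (norm_inner_le_norm w z).trans
    (mul_le_of_le_one_left (norm_nonneg _) hw)
  have h2 := norm_sub_norm_le (1 : ℂ) (inner ℂ w z)
  rw [norm_one] at h2
  linarith

lemma one_sub_inner_ne_zero {n : ℕ} {w z : En n} (hw : ‖w‖ ≤ 1) (hz : ‖z‖ < 1) :
    1 - (inner ℂ w z : ℂ) ≠ 0 := by
  have := one_sub_norm_le_norm_one_sub_inner (z := z) hw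
  rw [← norm_pos_iff]
  linarith

lemma continuousOn_kernel_pow {n : ℕ} {z : En n} (hz : ‖z‖ < 1) (q : ℕ) :
    ContinuousOn (fun w : En n => 1 / (1 - (inner ℂ w z : ℂ)) ^ q) (ball 0 1) := by
  apply ContinuousOn.div continuousOn_const
  · exact Continuous.continuousOn (by fun_prop)
  · intro w hw
    exact pow_ne_zero _ (one_sub_inner_ne_zero (mem_ball_zero_iff.1 hw).le hz)

lemma hasDerivAt_integral_kernel {n : ℕ} {Φ : En n → ℂ} (hΦ : IntegrableOn Φ (ball 0 1))
    (x u : En n) (s₀ : ℂ) (hs₀ : ‖x + s₀ • u‖ < 1) (q : ℕ) :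
    HasDerivAt (fun s : ℂ => ∫ w in ball (0 : En n) 1, Φ w * (1 / (1 - inner ℂ w (x + s • u)) ^ q))
      (q * ∫ w in ball (0 : En n) 1,
        (Φ w * inner ℂ w u) * (1 / (1 - inner ℂ w (x + s₀ • u)) ^ (q + 1))) s₀ := by
  obtain ⟨ρ, hρ0, hρ1⟩ := exists_between hs₀
  have hcont : Continuous fun s : ℂ => ‖x + s • u‖ := by fun_prop
  have hmem : {s : ℂ | ‖x + s • u‖ < ρ} ∈ nhds s₀ :=
    (isOpen_lt hcont continuous_const).mem_nhds hρ0
  have hmeasΦ : AEStronglyMeasurable Φ (volume.restrict (ball 0 1)) := hΦ.aestronglyMeasurable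
  have hK : ∀ z : En n, ‖z‖ < 1 → ∀ m : ℕ, AEStronglyMeasurable
      (fun w : En n => 1 / (1 - (inner ℂ w z : ℂ)) ^ m) (volume.restrict (ball 0 1)) :=
    fun z hz m => (continuousOn_kernel_pow hz m).aestronglyMeasurable measurableSet_ball
  have hKb : ∀ z : En n, ‖z‖ < ρ → ∀ m : ℕ, ∀ w ∈ ball (0 : En n) 1,
      ‖1 / (1 - (inner ℂ w z : ℂ)) ^ m‖ ≤ 1 / (1 - ρ) ^ m := by
    intro z hz m w hw
    rw [norm_div, norm_one, norm_pow]
    have h1 := one_sub_norm_le_norm_one_sub_inner (z := z) (mem_ball_zero_iff.1 hw).le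
    have h2 : 0 < 1 - ρ := by linarith
    gcongr
    linarith
  have hub : ∀ w ∈ ball (0 : En n) 1, ‖(inner ℂ w u : ℂ)‖ ≤ ‖u‖ := fun w hw =>
    (norm_inner_le_norm w u).trans
      (mul_le_of_le_one_left (norm_nonneg _) (mem_ball_zero_iff.1 hw).le)
  have h := hasDerivAt_integral_of_dominated_loc_of_deriv_le (𝕜 := ℂ)
    (μ := volume.restrict (ball (0 : En n) 1))
    (F := fun (s : ℂ) w => Φ w * (1 / (1 - inner ℂ w (x + s • u)) ^ q))
    (F' := fun (s : ℂ) w => q * ((Φ w * inner ℂ w u) * (1 / (1 - inner ℂ w (x + s • u)) ^ (q + 1))))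
    (bound := fun w => q * (‖Φ w‖ * ‖u‖ * (1 / (1 - ρ) ^ (q + 1))))
    (x₀ := s₀) hmem ?_ ?_ ?_ ?_ ?_ ?_
  · rw [← integral_const_mul]
    exact h.2
  · filter_upwards [hmem] with s hs
    exact hmeasΦ.mul (hK _ (lt_trans hs hρ1) q)
  · refine Integrable.mul_bdd (c := 1 / (1 - ρ) ^ q) hΦ (hK _ hs₀ q) ?_
    filter_upwards [ae_restrict_mem measurableSet_ball] with w hw
    exact hKb _ hρ0 q w hw
  · refine ((hmeasΦ.mul ?_).mul (hK _ hs₀ (q + 1))).const_mul _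
    exact Continuous.aestronglyMeasurable (by fun_prop)
  · filter_upwards [ae_restrict_mem measurableSet_ball] with w hw s hs
    have h1 := hKb _ hs (q + 1) w hw
    have h2 := hub w hw
    rw [norm_mul, norm_mul, norm_mul, Complex.norm_natCast]
    gcongr
  · exact ((hΦ.norm.mul_const _).mul_const _).const_mul _
  · filter_upwards [ae_restrict_mem measurableSet_ball] with w hw s hs
    have hne := one_sub_inner_ne_zero (mem_ball_zero_iff.1 hw).le (lt_trans hs hρ1)
    have e : ∀ s : ℂ, (inner ℂ w (x + s • u) : ℂ) = inner ℂ w x + s * inner ℂ w u := by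
      intro s; rw [inner_add_right, inner_smul_right]
    simp only [e] at hne ⊢
    have hd : HasDerivAt (fun s : ℂ => 1 - (inner ℂ w x + s * inner ℂ w u))
        (-(inner ℂ w u)) s := by
      simpa using (((hasDerivAt_id s).mul_const (inner ℂ w u)).const_add (inner ℂ w x)).const_sub 1
    have hd2 := ((hd.pow q).inv (pow_ne_zero _ hne)).const_mul (Φ w)
    simp only [one_div]
    refine hd2.congr_deriv ?_
    rw [Pi.pow_apply]
    rcases q with _ | q
    · simp
    · rw [Nat.add_sub_cancel]
      field_simp
      ring

/-- Mean over the unit ball of `ℂⁿ`. -/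
def unitBallMean {n : ℕ} (H : En n → ℂ) : ℂ :=
  ((n.factorial / Real.pi ^ n : ℝ) : ℂ) * ∫ w in ball (0 : En n) 1, H w

lemma unitBallMean_kernel {n : ℕ} (hn : 0 < n) {F : En n → ℂ}
    (hF : DifferentiableOn ℂ F (ball 0 1)) (hFi : IntegrableOn F (ball 0 1))
    {z : En n} (hz : ‖z‖ < 1) :
    unitBallMean (fun w => F w * (1 / (1 - inner ℂ w z) ^ (n + 1))) = F z := by
  rw [unitBallMean, bergman_reproducing hn hF hFi hz, ← mul_assoc, ← Complex.ofReal_mul]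
  have : (n.factorial / Real.pi ^ n * (Real.pi ^ n / n.factorial) : ℝ) = 1 := by
    have : (n.factorial : ℝ) ≠ 0 := by exact_mod_cast n.factorial_ne_zero
    field_simp
  rw [this]; simp

lemma hasDerivAt_unitBallMean_kernel {n : ℕ} {Φ : En n → ℂ} (hΦ : IntegrableOn Φ (ball 0 1))
    (x u : En n) (s₀ : ℂ) (hs₀ : ‖x + s₀ • u‖ < 1) (q : ℕ) :
    HasDerivAt (fun s : ℂ => unitBallMean fun w => Φ w * (1 / (1 - inner ℂ w (x + s • u)) ^ q))
      (q * unitBallMean fun w =>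
        (Φ w * inner ℂ w u) * (1 / (1 - inner ℂ w (x + s₀ • u)) ^ (q + 1))) s₀ := by
  unfold unitBallMean
  exact ((hasDerivAt_integral_kernel hΦ x u s₀ hs₀ q).const_mul
    ((n.factorial / Real.pi ^ n : ℝ) : ℂ)).congr_deriv (mul_left_comm _ _ _)

lemma hasDerivAt_line {n : ℕ} (hn : 0 < n) {F : En n → ℂ}
    (hF : DifferentiableOn ℂ F (ball 0 1)) (hFi : IntegrableOn F (ball 0 1))
    (x u : En n) (s₀ : ℂ) (hs₀ : ‖x + s₀ • u‖ < 1) :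
    HasDerivAt (fun s : ℂ => F (x + s • u)) (((n : ℂ) + 1) * unitBallMean fun w =>
        (F w * inner ℂ w u) * (1 / (1 - inner ℂ w (x + s₀ • u)) ^ (n + 2))) s₀ := by
  have h := hasDerivAt_unitBallMean_kernel hFi x u s₀ hs₀ (n + 1)
  push_cast at h
  refine h.congr_of_eventuallyEq ?_
  have hcont : Continuous fun s : ℂ => ‖x + s • u‖ := by fun_prop
  filter_upwards [(isOpen_lt hcont continuous_const).mem_nhds hs₀] with s hs
  exact (unitBallMean_kernel hn hF hFi hs).symm

lemma fderiv_eq_unitBallMean {n : ℕ} (hn : 0 < n) {F : En n → ℂ}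
    (hF : DifferentiableOn ℂ F (ball 0 1)) (hFi : IntegrableOn F (ball 0 1))
    {x : En n} (u : En n) (hx : ‖x‖ < 1) :
    fderiv ℂ F x u = ((n : ℂ) + 1) * unitBallMean fun w =>
        (F w * inner ℂ w u) * (1 / (1 - inner ℂ w x) ^ (n + 2)) := by
  have h := hasDerivAt_line hn hF hFi x u 0 (by simpa using hx)
  simp only [zero_smul, add_zero] at h
  have h1 : DifferentiableAt ℂ F x :=
    hF.differentiableAt (isOpen_ball.mem_nhds (mem_ball_zero_iff.2 hx))
  have h2 : HasDerivAt (fun s : ℂ => x + s • u) u 0 := by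
    simpa using ((hasDerivAt_id (0 : ℂ)).smul_const u).const_add x
  have h3 := (h1.hasFDerivAt.congr_fderiv rfl : HasFDerivAt F (fderiv ℂ F x) x)
  have h3' : HasFDerivAt F (fderiv ℂ F x) (x + (0 : ℂ) • u) := by simpa using h3
  exact (h3'.comp_hasDerivAt 0 h2).unique h

lemma integrableOn_ball_of_bounded {n : ℕ} {T : En n → ℂ} (hT : ContinuousOn T (ball 0 1))
    {b : ℝ} (hb : ∀ w ∈ ball (0 : En n) 1, ‖T w‖ ≤ b) : IntegrableOn T (ball 0 1) := by
  refine Integrable.mono' (g := fun _ => b) (integrableOn_const measure_ball_lt_top.ne)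
    (hT.aestronglyMeasurable measurableSet_ball) ?_
  filter_upwards [ae_restrict_mem measurableSet_ball] with w hw
  exact hb w hw

lemma hasSum_setIntegral_ball_of_bounded {n : ℕ} {T : ℕ → En n → ℂ} {S : En n → ℂ}
    (hT : ∀ j, ContinuousOn (T j) (ball 0 1)) {b : ℕ → ℝ} (hbs : Summable b)
    (hb : ∀ j, ∀ w ∈ ball (0 : En n) 1, ‖T j w‖ ≤ b j)
    (hS : ∀ w ∈ ball (0 : En n) 1, HasSum (fun j => T j w) (S w)) :
    HasSum (fun j => ∫ w in ball (0 : En n) 1, T j w) (∫ w in ball (0 : En n) 1, S w) := by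
  have hTi : ∀ j, IntegrableOn (T j) (ball 0 1) := fun j =>
    integrableOn_ball_of_bounded (hT j) (hb j)
  have hsum : Summable fun j => ∫ w in ball (0 : En n) 1, ‖T j w‖ := by
    refine Summable.of_nonneg_of_le (fun j => integral_nonneg fun w => norm_nonneg _) (fun j => ?_)
      (hbs.mul_left (volume.real (ball (0 : En n) 1)))
    have : ∫ w in ball (0 : En n) 1, ‖T j w‖ ≤ ∫ w in ball (0 : En n) 1, b j :=
      setIntegral_mono_on (hTi j).norm (integrableOn_const measure_ball_lt_top.ne)
        measurableSet_ball (hb j)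
    rwa [setIntegral_const, smul_eq_mul] at this
  have h := hasSum_integral_of_summable_integral_norm hTi hsum
  rwa [setIntegral_congr_fun measurableSet_ball fun w hw => (hS w hw).tsum_eq] at h

lemma hasSum_setIntegral_ball_norm_sq {n : ℕ} {a : ℕ → En n → ℂ} {S : En n → ℂ}
    (ha : ∀ j, ContinuousOn (a j) (ball 0 1)) (hSc : ContinuousOn S (ball 0 1))
    {b : ℕ → ℝ} (hbs : Summable b)
    (hb : ∀ j, ∀ w ∈ ball (0 : En n) 1, ‖a j w‖ ≤ b j)
    (hS : ∀ w ∈ ball (0 : En n) 1, HasSum (fun j => a j w) (S w))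
    (horth : ∀ i j, i ≠ j → ∫ w in ball (0 : En n) 1, a i w * starRingEnd ℂ (a j w) = 0) :
    HasSum (fun j => ∫ w in ball (0 : En n) 1, ‖a j w‖ ^ 2)
      (∫ w in ball (0 : En n) 1, ‖S w‖ ^ 2) := by
  have hb0 : ∀ j, 0 ≤ b j := fun j =>
    (norm_nonneg _).trans (hb j 0 (mem_ball_self one_pos))
  have hSb : ∀ w ∈ ball (0 : En n) 1, ‖S w‖ ≤ ∑' j, b j := by
    intro w hw
    rw [← (hS w hw).tsum_eq]
    exact tsum_of_norm_bounded hbs.hasSum fun j => hb j w hw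
  have hA : ∀ j, ∫ w in ball (0 : En n) 1, S w * starRingEnd ℂ (a j w)
      = ((∫ w in ball (0 : En n) 1, ‖a j w‖ ^ 2 : ℝ) : ℂ) := by
    intro j
    have h1 := hasSum_setIntegral_ball_of_bounded
      (T := fun i w => a i w * starRingEnd ℂ (a j w)) (S := fun w => S w * starRingEnd ℂ (a j w))
      (fun i => (ha i).mul (Complex.continuous_conj.comp_continuousOn (ha j)))
      (b := fun i => b i * b j) (hbs.mul_right _)
      (fun i w hw => by
        rw [norm_mul, RCLike.norm_conj]
        have h1 := hb i w hw
        have h2 := hb j w hw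
        have h3 := hb0 i
        gcongr)
      (fun w hw => (hS w hw).mul_right _)
    have h2 := hasSum_single
      (f := fun i => ∫ w in ball (0 : En n) 1, a i w * starRingEnd ℂ (a j w)) j
      (fun i hij => horth i j hij)
    rw [h1.unique h2, ← integral_complex_ofReal]
    congr 1
    ext w
    rw [Complex.mul_conj, Complex.normSq_eq_norm_sq]
  have hB := hasSum_setIntegral_ball_of_bounded
    (T := fun j w => S w * starRingEnd ℂ (a j w)) (S := fun w => S w * starRingEnd ℂ (S w))
    (fun j => hSc.mul (Complex.continuous_conj.comp_continuousOn (ha j)))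
    (b := fun j => (∑' j, b j) * b j) (hbs.mul_left _)
    (fun j w hw => by
      rw [norm_mul, RCLike.norm_conj]
      have h1 := hSb w hw
      have h2 := hb j w hw
      have h3 : 0 ≤ ∑' j, b j := tsum_nonneg hb0
      gcongr)
    (fun w hw => ((hS w hw).map (starRingEnd ℂ) Complex.continuous_conj).mul_left _)
  simp only [hA, Complex.mul_conj, Complex.normSq_eq_norm_sq] at hB
  rw [integral_complex_ofReal] at hB
  exact_mod_cast hB

lemma pow_mul_pow_mul_pow_le {x y z : ℝ} (hx : 0 ≤ x) (hy : 0 ≤ y) (hz : 0 ≤ z) (a b c : ℕ)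
    (hm : 0 < a + b + c) :
    x ^ a * y ^ b * z ^ c ≤ (a * x ^ (a + b + c) + b * y ^ (a + b + c) + c * z ^ (a + b + c)) /
      ((a + b + c : ℕ) : ℝ) := by
  set m := a + b + c with hmdef
  have hm0 : (m : ℝ) ≠ 0 := by exact_mod_cast hm.ne'
  have key : ∀ (t : ℝ) (e : ℕ), 0 ≤ t → (t ^ m) ^ ((e : ℝ) / m) = t ^ e := by
    intro t e ht
    rw [← Real.rpow_natCast t m, ← Real.rpow_mul ht, mul_div_cancel₀ _ hm0, Real.rpow_natCast]
  have h := Real.geom_mean_le_arith_mean3_weighted (w₁ := (a : ℝ) / m) (w₂ := (b : ℝ) / m)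
    (w₃ := (c : ℝ) / m) (p₁ := x ^ m) (p₂ := y ^ m) (p₃ := z ^ m) (by positivity) (by positivity)
    (by positivity) (by positivity) (by positivity) (by positivity)
    (by rw [← add_div, ← add_div, div_eq_one_iff_eq hm0, hmdef]; push_cast; ring)
  rw [key x a hx, key y b hy, key z c hz] at h
  refine h.trans (le_of_eq ?_)
  ring

lemma setIntegral_ball_moment_mul_le_of_unit {n : ℕ} {v u z : En n} (hv : ‖v‖ = 1) (hu : ‖u‖ = 1)
    (hz : ‖z‖ = 1) (a b c : ℕ) (hm : 0 < a + b + c) :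
    ∫ w in ball (0 : En n) 1, ‖(inner ℂ v w : ℂ)‖ ^ (2 * a) * ‖(inner ℂ u w : ℂ)‖ ^ (2 * b) *
        ‖(inner ℂ z w : ℂ)‖ ^ (2 * c)
      ≤ Real.pi ^ n * (a + b + c).factorial / (n + (a + b + c)).factorial := by
  set m := a + b + c with hmdef
  have hi : ∀ {G : En n → ℝ}, Continuous G → IntegrableOn G (ball 0 1) := fun hG =>
    (hG.continuousOn.integrableOn_compact (isCompact_closedBall 0 1)).mono_set
      ball_subset_closedBall
  have hm0 : (m : ℝ) ≠ 0 := by exact_mod_cast hm.ne'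
  have h1 : ∫ w in ball (0 : En n) 1, ‖(inner ℂ v w : ℂ)‖ ^ (2 * a) *
      ‖(inner ℂ u w : ℂ)‖ ^ (2 * b) * ‖(inner ℂ z w : ℂ)‖ ^ (2 * c) ≤
      ∫ w in ball (0 : En n) 1, (a * ‖(inner ℂ v w : ℂ)‖ ^ (2 * m) +
        b * ‖(inner ℂ u w : ℂ)‖ ^ (2 * m) + c * ‖(inner ℂ z w : ℂ)‖ ^ (2 * m)) / m := by
    refine setIntegral_mono_on (hi (by fun_prop)) (hi (by fun_prop)) measurableSet_ball ?_
    intro w _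
    simp only [pow_mul]
    exact pow_mul_pow_mul_pow_le (by positivity) (by positivity) (by positivity) a b c hm
  refine h1.trans (le_of_eq ?_)
  rw [integral_div, integral_add (hi (by fun_prop)) (hi (by fun_prop)),
    integral_add (hi (by fun_prop)) (hi (by fun_prop)), integral_const_mul, integral_const_mul,
    integral_const_mul, setIntegral_ball_moment m v hv, setIntegral_ball_moment m u hu,
    setIntegral_ball_moment m z hz, div_eq_iff hm0, hmdef]
  push_cast
  ring

lemma setIntegral_ball_moment_mul_le {n : ℕ} (hn : 0 < n) (v u z : En n)
    (a b c : ℕ) (hm : 0 < a + b + c) :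
    ∫ w in ball (0 : En n) 1, ‖(inner ℂ v w : ℂ)‖ ^ (2 * a) * ‖(inner ℂ u w : ℂ)‖ ^ (2 * b) *
        ‖(inner ℂ z w : ℂ)‖ ^ (2 * c)
      ≤ ‖v‖ ^ (2 * a) * ‖u‖ ^ (2 * b) * ‖z‖ ^ (2 * c) *
        (Real.pi ^ n * (a + b + c).factorial / (n + (a + b + c)).factorial) := by
  obtain ⟨v', hv', hv⟩ := exists_unit_smul_eq hn v
  obtain ⟨u', hu', hu⟩ := exists_unit_smul_eq hn u
  obtain ⟨z', hz', hz⟩ := exists_unit_smul_eq hn z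
  have key : ∀ x x' : En n, x = (‖x‖ : ℂ) • x' → ∀ w,
      ‖(inner ℂ x w : ℂ)‖ = ‖x‖ * ‖(inner ℂ x' w : ℂ)‖ := by
    intro x x' h w
    conv_lhs => rw [h, inner_smul_left, norm_mul, RCLike.norm_conj, Complex.norm_real, norm_norm]
  have h := mul_le_mul_of_nonneg_left
    (setIntegral_ball_moment_mul_le_of_unit hv' hu' hz' a b c hm)
    (by positivity : 0 ≤ ‖v‖ ^ (2 * a) * ‖u‖ ^ (2 * b) * ‖z‖ ^ (2 * c))
  rw [← integral_const_mul] at h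
  refine (le_of_eq ?_).trans h
  congr 1
  ext w
  rw [key v v' hv, key u u' hu, key z z' hz]
  ring

lemma factorial_mul_factorial_add_le {N j : ℕ} (h : j ≤ N) (k : ℕ) :
    N.factorial * (j + k).factorial ≤ (N + k).factorial * j.factorial := by
  induction k with
  | zero => simp
  | succ k ih =>
    rw [← add_assoc, ← add_assoc, Nat.factorial_succ, Nat.factorial_succ]
    calc N.factorial * ((j + k + 1) * (j + k).factorial)
        = (j + k + 1) * (N.factorial * (j + k).factorial) := by ring
      _ ≤ (N + k + 1) * ((N + k).factorial * j.factorial) :=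
        Nat.mul_le_mul (by omega) ih
      _ = _ := by ring

lemma choose_coefficient_le (n k j : ℕ) :
    ((n + k).choose k : ℝ) * (((n + k + j).choose (n + k) : ℝ) ^ 2 *
      (n.factorial * (k + j).factorial / (n + (k + j)).factorial)) ≤
    ((n + 2 * k).choose k : ℝ) * ((n + 2 * k + j).choose (n + 2 * k) : ℝ) := by
  have e1 : ((n + k).choose k : ℝ) = (n + k).factorial / (n.factorial * k.factorial) := by
    rw [Nat.choose_symm_add.symm, Nat.cast_add_choose]
  have e2 := Nat.cast_add_choose ℝ (a := n + k) (b := j)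
  have e3 : ((n + 2 * k).choose k : ℝ) = (n + 2 * k).factorial /
      ((n + k).factorial * k.factorial) := by
    rw [two_mul, ← add_assoc, Nat.choose_symm_add.symm, Nat.cast_add_choose]
  have e4 := Nat.cast_add_choose ℝ (a := n + 2 * k) (b := j)
  have h : ((n + k + j).factorial : ℝ) * (j + k).factorial ≤
      (n + 2 * k + j).factorial * j.factorial := by
    have := factorial_mul_factorial_add_le (N := n + k + j) (j := j) (by omega) k
    rw [show n + k + j + k = n + 2 * k + j by ring] at this
    exact_mod_cast this
  rw [e1, e2, e3, e4, ← add_assoc, add_comm k j]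
  have p : ∀ m : ℕ, (0 : ℝ) < m.factorial := fun m => by exact_mod_cast m.factorial_pos
  have p1 := p (n + k); have p2 := p n; have p3 := p k; have p4 := p j
  have p5 := p (n + k + j); have p6 := p (n + 2 * k)
  have l : ((n + k).factorial / (n.factorial * k.factorial) : ℝ) *
      (((n + k + j).factorial / ((n + k).factorial * j.factorial)) ^ 2 *
        (n.factorial * (j + k).factorial / (n + k + j).factorial)) =
      ((n + k + j).factorial * (j + k).factorial) /
        (k.factorial * (n + k).factorial * j.factorial ^ 2) := by
    field_simp
  have r : ((n + 2 * k).factorial / ((n + k).factorial * k.factorial) : ℝ) *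
      ((n + 2 * k + j).factorial / ((n + 2 * k).factorial * j.factorial)) =
      ((n + 2 * k + j).factorial * j.factorial) /
        (k.factorial * (n + k).factorial * j.factorial ^ 2) := by
    field_simp
  rw [l, r]
  gcongr

lemma a2Norm_unit_sq {𝓕 : Type*} [NormedAddCommGroup 𝓕] {n : ℕ} (f : En n → 𝓕) :
    A2Norm 0 1 f ^ 2 = n.factorial / Real.pi ^ n * ∫ w in ball (0 : En n) 1, ‖f w‖ ^ 2 := by
  rw [A2Norm, Real.sq_sqrt]
  · simp
  · exact mul_nonneg (by positivity) (integral_nonneg fun _ => by positivity)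

lemma a2Norm_nonneg {𝓕 : Type*} [NormedAddCommGroup 𝓕] {n : ℕ} (ω : En n) (R : ℝ)
    (f : En n → 𝓕) : 0 ≤ A2Norm ω R f := Real.sqrt_nonneg _

lemma norm_unitBallMean_mul_conj_le {n : ℕ} {F h : En n → ℂ}
    (hF : AEStronglyMeasurable F (volume.restrict (ball 0 1)))
    (hF2 : IntegrableOn (fun w => ‖F w‖ ^ 2) (ball 0 1))
    (hh : AEStronglyMeasurable h (volume.restrict (ball 0 1)))
    (hh2 : IntegrableOn (fun w => ‖h w‖ ^ 2) (ball 0 1)) :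
    ‖unitBallMean fun w => F w * starRingEnd ℂ (h w)‖ ≤ A2Norm 0 1 F * A2Norm 0 1 h := by
  have hFL : MemLp F (ENNReal.ofReal 2) (volume.restrict (ball 0 1)) := by
    rw [ENNReal.ofReal_ofNat]; exact (memLp_two_iff_integrable_sq_norm hF).2 hF2
  have hhL : MemLp h (ENNReal.ofReal 2) (volume.restrict (ball 0 1)) := by
    rw [ENNReal.ofReal_ofNat]; exact (memLp_two_iff_integrable_sq_norm hh).2 hh2
  have hc : (0 : ℝ) ≤ n.factorial / Real.pi ^ n := by positivity
  have h1 := integral_mul_norm_le_Lp_mul_Lq Real.HolderConjugate.two_two hFL hhL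
  simp only [Real.rpow_two, ← Real.sqrt_eq_rpow] at h1
  have h2 : ‖∫ w in ball (0 : En n) 1, F w * starRingEnd ℂ (h w)‖ ≤
      ∫ w in ball (0 : En n) 1, ‖F w‖ * ‖h w‖ := by
    refine (norm_integral_le_integral_norm _).trans (le_of_eq ?_)
    simp only [norm_mul, RCLike.norm_conj]
  rw [unitBallMean, norm_mul, Complex.norm_real, Real.norm_of_nonneg hc, A2Norm, A2Norm]
  simp only [one_pow, mul_one]
  rw [Real.sqrt_mul hc, Real.sqrt_mul hc, mul_mul_mul_comm, Real.mul_self_sqrt hc]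
  exact mul_le_mul_of_nonneg_left (h2.trans h1) hc

lemma norm_inner_lt_one {n : ℕ} {z w : En n} (hz : ‖z‖ < 1) (hw : ‖w‖ ≤ 1) :
    ‖(inner ℂ z w : ℂ)‖ < 1 :=
  (norm_inner_le_norm z w).trans_lt
    ((mul_le_of_le_one_right (norm_nonneg _) hw).trans_lt hz)

lemma continuousOn_conj_kernel {n : ℕ} {ζ : En n} (hζ : ‖ζ‖ < 1) (v u : En n) (i q : ℕ) :
    ContinuousOn (fun w : En n => (inner ℂ v w : ℂ) ^ i * inner ℂ u w *
      (1 / (1 - inner ℂ ζ w) ^ q)) (ball 0 1) := by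
  refine ContinuousOn.mul (Continuous.continuousOn (by fun_prop)) (ContinuousOn.div
    continuousOn_const (Continuous.continuousOn (by fun_prop)) fun w hw => ?_)
  refine pow_ne_zero _ (sub_ne_zero.2 fun h => ?_)
  have := norm_inner_lt_one hζ (mem_ball_zero_iff.1 hw).le
  rw [← h, norm_one] at this
  exact lt_irrefl _ this

lemma a2Norm_conj_kernel_sq_le {n : ℕ} (hn : 0 < n) {ζ : En n} (hζ : ‖ζ‖ < 1) (v u : En n)
    (i : ℕ) :
    ((n + (i + 1)).choose (i + 1) : ℝ) * A2Norm 0 1 (fun w : En n =>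
      (inner ℂ v w : ℂ) ^ i * inner ℂ u w * (1 / (1 - inner ℂ ζ w) ^ (n + (i + 1) + 1))) ^ 2 ≤
    ((n + 2 * (i + 1)).choose (i + 1) : ℝ) * (‖v‖ ^ (2 * i) * ‖u‖ ^ 2) *
      (1 / (1 - ‖ζ‖ ^ 2) ^ (n + 2 * (i + 1) + 1)) := by
  set k := i + 1 with hk
  set a : ℕ → En n → ℂ := fun j w => ((j + (n + k)).choose (n + k) : ℂ) *
    ((inner ℂ v w : ℂ) ^ i * inner ℂ u w * (inner ℂ ζ w) ^ j) with ha
  have hle : ∀ (y w : En n), w ∈ ball (0 : En n) 1 → ‖(inner ℂ y w : ℂ)‖ ≤ ‖y‖ := fun y w hw =>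
    (norm_inner_le_norm y w).trans
      (mul_le_of_le_one_right (norm_nonneg _) (mem_ball_zero_iff.1 hw).le)
  have hP := hasSum_setIntegral_ball_norm_sq (a := a) (S := fun w : En n =>
      (inner ℂ v w : ℂ) ^ i * inner ℂ u w * (1 / (1 - inner ℂ ζ w) ^ (n + k + 1)))
    (b := fun j => ((j + (n + k)).choose (n + k) : ℝ) * ‖ζ‖ ^ j * (‖v‖ ^ i * ‖u‖))
    (fun j => Continuous.continuousOn (by fun_prop)) (continuousOn_conj_kernel hζ v u i _)
    ?_ ?_ ?_ ?_
  rotate_left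
  · exact ((hasSum_choose_mul_geometric_of_norm_lt_one (n + k) (r := ‖ζ‖)
      (by simpa using hζ)).summable).mul_right _
  · intro j w hw
    have h1 := hle v w hw
    have h2 := hle u w hw
    have h3 := hle ζ w hw
    simp only [ha, norm_mul, norm_pow, Complex.norm_natCast]
    calc _ ≤ ((j + (n + k)).choose (n + k) : ℝ) * (‖v‖ ^ i * ‖u‖ * ‖ζ‖ ^ j) := by gcongr
      _ = _ := by ring
  · intro w hw
    refine ((hasSum_choose_mul_geometric_of_norm_lt_one (n + k) (r := (inner ℂ ζ w : ℂ))
      (norm_inner_lt_one hζ (mem_ball_zero_iff.1 hw).le)).mul_left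
        ((inner ℂ v w : ℂ) ^ i * inner ℂ u w)).congr_fun fun j => ?_
    simp only [ha]
    ring
  · intro p q hpq
    refine setIntegral_ball_eq_zero_of_homogeneous (j := k + p) (k := k + q) (by omega) ?_ 1
    intro c w _
    simp only [ha, inner_smul_right, map_mul, map_pow, map_natCast, hk]
    ring
  have hG := (hasSum_choose_mul_geometric_of_norm_lt_one (n + 2 * k) (r := ‖ζ‖ ^ 2)
    (by rw [norm_pow, norm_norm]; exact pow_lt_one₀ (norm_nonneg _) hζ two_ne_zero)).mul_left
    (((n + 2 * k).choose k : ℝ) * (‖v‖ ^ (2 * i) * ‖u‖ ^ 2))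
  rw [a2Norm_unit_sq, ← mul_assoc]
  refine hasSum_le (fun j => ?_) (hP.mul_left _) hG
  have hI : ∫ w in ball (0 : En n) 1, ‖a j w‖ ^ 2 ≤ ((j + (n + k)).choose (n + k) : ℝ) ^ 2 *
      (‖v‖ ^ (2 * i) * ‖u‖ ^ (2 * 1) * ‖ζ‖ ^ (2 * j) *
        (Real.pi ^ n * (i + 1 + j).factorial / (n + (i + 1 + j)).factorial)) := by
    refine le_trans (le_of_eq ?_) (mul_le_mul_of_nonneg_left
      (setIntegral_ball_moment_mul_le hn v u ζ i 1 j (by omega)) (sq_nonneg _))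
    rw [← integral_const_mul]
    congr 1
    ext w
    simp only [ha, norm_mul, norm_pow, Complex.norm_natCast]
    ring
  have hC := mul_le_mul_of_nonneg_right (choose_coefficient_le n k j)
    (by positivity : 0 ≤ ‖v‖ ^ (2 * i) * ‖u‖ ^ 2 * ‖ζ‖ ^ (2 * j))
  have hpi : Real.pi ≠ 0 := Real.pi_ne_zero
  calc _ ≤ ((n + k).choose k : ℝ) * (n.factorial / Real.pi ^ n) *
        (((j + (n + k)).choose (n + k) : ℝ) ^ 2 *
      (‖v‖ ^ (2 * i) * ‖u‖ ^ (2 * 1) * ‖ζ‖ ^ (2 * j) *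
        (Real.pi ^ n * (i + 1 + j).factorial / (n + (i + 1 + j)).factorial))) := by gcongr
    _ = ((n + k).choose k : ℝ) * (((n + k + j).choose (n + k) : ℝ) ^ 2 *
      (n.factorial * (k + j).factorial / (n + (k + j)).factorial)) *
        (‖v‖ ^ (2 * i) * ‖u‖ ^ 2 * ‖ζ‖ ^ (2 * j)) := by
      rw [add_comm j (n + k), ← hk]
      field_simp
      ring
    _ ≤ _ := hC
    _ = _ := by
      rw [add_comm j (n + 2 * k)]
      ring

lemma choose_ratio_step {m k : ℕ} (hm : 3 ≤ m) (hk : 1 ≤ k) :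
    (m + 2 * k) * (m + 2 * k + 1) ≤ m ^ 2 * (k + 1) ^ 2 := by
  have h1 : m + 2 * k + 1 ≤ m * (k + 1) := by nlinarith
  have h2 : m + 2 * k ≤ m * (k + 1) := by omega
  calc _ ≤ (m * (k + 1)) * (m * (k + 1)) := Nat.mul_le_mul h2 h1
    _ = _ := by ring

lemma factorial_add_two_mul_le_of_base {n k₀ : ℕ} (hn : 2 ≤ n) (hk₀ : 1 ≤ k₀)
    (h : (n + 2 * k₀).factorial ≤ (n + 1) ^ (2 * k₀) * n.factorial * k₀.factorial ^ 2)
    {k : ℕ} (hk : k₀ ≤ k) :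
    (n + 2 * k).factorial ≤ (n + 1) ^ (2 * k) * n.factorial * k.factorial ^ 2 := by
  induction k, hk using Nat.le_induction with
  | base => exact h
  | succ k hk ih =>
    have := choose_ratio_step (m := n + 1) (k := k) (by omega) (by omega)
    calc (n + 2 * (k + 1)).factorial
        = ((n + 1 + 2 * k) * (n + 1 + 2 * k + 1)) * (n + 2 * k).factorial := by
          rw [show n + 2 * (k + 1) = n + 2 * k + 1 + 1 by ring, Nat.factorial_succ,
            Nat.factorial_succ]
          ring
      _ ≤ ((n + 1) ^ 2 * (k + 1) ^ 2) *
          ((n + 1) ^ (2 * k) * n.factorial * k.factorial ^ 2) := Nat.mul_le_mul this ih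
      _ = _ := by rw [Nat.factorial_succ]; ring

lemma factorial_add_two_mul_le {n k : ℕ} (h : 3 ≤ n ∧ 2 ≤ k ∨ n = 2 ∧ 3 ≤ k) :
    (n + 2 * k).factorial ≤ (n + 1) ^ (2 * k) * n.factorial * k.factorial ^ 2 := by
  rcases h with ⟨hn, hk⟩ | ⟨rfl, hk⟩
  · refine factorial_add_two_mul_le_of_base (by omega) (by norm_num) ?_ hk
    have h4 : (n + 2 * 2).factorial =
        ((n + 1) * (n + 2) * (n + 3) * (n + 4)) * n.factorial := by
      rw [show n + 2 * 2 = n + 3 + 1 by ring, Nat.factorial_succ, Nat.factorial_succ,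
        Nat.factorial_succ, Nat.factorial_succ]
      ring
    have h5 : (n + 1) * (n + 2) * (n + 3) * (n + 4) ≤ (n + 1) ^ 4 * 4 := by
      obtain ⟨t, rfl⟩ := Nat.exists_eq_add_of_le hn
      ring_nf
      nlinarith [sq_nonneg t, Nat.zero_le (t ^ 3), Nat.zero_le (t ^ 4)]
    rw [h4, show (n + 1) ^ (2 * 2) * n.factorial * Nat.factorial 2 ^ 2 =
      ((n + 1) ^ 4 * 4) * n.factorial by rw [Nat.factorial_two]; ring]
    exact Nat.mul_le_mul_right _ h5
  · exact factorial_add_two_mul_le_of_base le_rfl (by norm_num) (by decide) hk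

lemma choose_mul_choose_le {n k : ℕ} (h : 3 ≤ n ∧ 2 ≤ k ∨ n = 2 ∧ 3 ≤ k) :
    ((n + k).choose k : ℝ) * ((n + 2 * k).choose k : ℝ) ≤ ((n : ℝ) + 1) ^ (2 * k) := by
  have e1 : ((n + k).choose k : ℝ) = (n + k).factorial / (n.factorial * k.factorial) := by
    rw [Nat.choose_symm_add.symm, Nat.cast_add_choose]
  have e3 : ((n + 2 * k).choose k : ℝ) = (n + 2 * k).factorial /
      ((n + k).factorial * k.factorial) := by
    rw [two_mul, ← add_assoc, Nat.choose_symm_add.symm, Nat.cast_add_choose]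
  have p : ∀ m : ℕ, (0 : ℝ) < m.factorial := fun m => by exact_mod_cast m.factorial_pos
  have p1 := p (n + k); have p2 := p n; have p3 := p k
  have h' : ((n + 2 * k).factorial : ℝ) ≤
      ((n : ℝ) + 1) ^ (2 * k) * n.factorial * k.factorial ^ 2 := by
    exact_mod_cast factorial_add_two_mul_le h
  rw [e1, e3]
  calc _ = ((n + 2 * k).factorial : ℝ) / (n.factorial * k.factorial ^ 2) := by field_simp
    _ ≤ _ := by rw [div_le_iff₀ (by positivity), ← mul_assoc]; exact h'

lemma conj_conj_kernel {n : ℕ} (ζ v u w : En n) (i q : ℕ) :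
    starRingEnd ℂ ((inner ℂ v w : ℂ) ^ i * inner ℂ u w * (1 / (1 - inner ℂ ζ w) ^ q)) =
      (inner ℂ w v : ℂ) ^ i * inner ℂ w u * (1 / (1 - inner ℂ w ζ) ^ q) := by
  simp only [map_mul, map_pow, map_div₀, map_sub, map_one, inner_conj_symm]

lemma norm_conj_kernel_le {n : ℕ} {ζ : En n} (hζ : ‖ζ‖ < 1) (v u : En n) (i q : ℕ) {w : En n}
    (hw : w ∈ ball (0 : En n) 1) :
    ‖(inner ℂ v w : ℂ) ^ i * inner ℂ u w * (1 / (1 - inner ℂ ζ w) ^ q)‖ ≤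
      ‖v‖ ^ i * ‖u‖ * (1 / (1 - ‖ζ‖) ^ q) := by
  have hle : ∀ y : En n, ‖(inner ℂ y w : ℂ)‖ ≤ ‖y‖ := fun y =>
    (norm_inner_le_norm y w).trans
      (mul_le_of_le_one_right (norm_nonneg _) (mem_ball_zero_iff.1 hw).le)
  have h1 : 1 - ‖ζ‖ ≤ ‖1 - (inner ℂ ζ w : ℂ)‖ := by
    have h2 := norm_sub_norm_le (1 : ℂ) (inner ℂ ζ w)
    rw [norm_one] at h2
    linarith [hle ζ]
  have h2 : 0 < 1 - ‖ζ‖ := by linarith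
  rw [norm_mul, norm_mul, norm_pow, norm_div, norm_one, norm_pow]
  have h3 := hle v
  have h4 := hle u
  gcongr

lemma integrableOn_of_sq {n : ℕ} {F : En n → ℂ}
    (hF : AEStronglyMeasurable F (volume.restrict (ball 0 1)))
    (hF2 : IntegrableOn (fun w => ‖F w‖ ^ 2) (ball 0 1)) : IntegrableOn F (ball 0 1) := by
  have : IsFiniteMeasure (volume.restrict (ball (0 : En n) 1)) :=
    ⟨by rw [Measure.restrict_apply_univ]; exact measure_ball_lt_top⟩
  exact ((memLp_two_iff_integrable_sq_norm hF).2 hF2).integrable one_le_two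

lemma integrableOn_mul_kernel {n : ℕ} {F : En n → ℂ} (hF : IntegrableOn F (ball 0 1))
    {ζ : En n} (hζ : ‖ζ‖ < 1) (v u : En n) (i q : ℕ) :
    IntegrableOn (fun w => F w * ((inner ℂ w v : ℂ) ^ i * inner ℂ w u *
      (1 / (1 - inner ℂ w ζ) ^ q))) (ball 0 1) := by
  simp only [← conj_conj_kernel]
  refine Integrable.mul_bdd (c := ‖v‖ ^ i * ‖u‖ * (1 / (1 - ‖ζ‖) ^ q)) hF
    ((Complex.continuous_conj.comp_continuousOn
      (continuousOn_conj_kernel hζ v u i q)).aestronglyMeasurable measurableSet_ball) ?_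
  filter_upwards [ae_restrict_mem measurableSet_ball] with w hw
  rw [RCLike.norm_conj]
  exact norm_conj_kernel_le hζ v u i q hw

lemma integrableOn_conj_kernel_sq {n : ℕ} {ζ : En n} (hζ : ‖ζ‖ < 1) (v u : En n) (i q : ℕ) :
    IntegrableOn (fun w => ‖(inner ℂ v w : ℂ) ^ i * inner ℂ u w *
      (1 / (1 - inner ℂ ζ w) ^ q)‖ ^ 2) (ball 0 1) := by
  refine Integrable.mono' (g := fun _ => (‖v‖ ^ i * ‖u‖ * (1 / (1 - ‖ζ‖) ^ q)) ^ 2)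
    (integrableOn_const measure_ball_lt_top.ne)
    (((continuousOn_conj_kernel hζ v u i q).norm.pow 2).aestronglyMeasurable
      measurableSet_ball) ?_
  filter_upwards [ae_restrict_mem measurableSet_ball] with w hw
  rw [norm_pow, norm_norm]
  have := norm_conj_kernel_le hζ v u i q hw
  gcongr

/-- The polarized Taylor coefficient of degree `i + 1` at `ζ`, in the directions `v` (`i` times)
and `u`. -/
def taylorTerm {n : ℕ} (F : En n → ℂ) (ζ v u : En n) (i : ℕ) : ℂ :=
  ((n + (i + 1)).choose (i + 1) : ℂ) * unitBallMean fun w =>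
    F w * ((inner ℂ w v : ℂ) ^ i * inner ℂ w u * (1 / (1 - inner ℂ w ζ) ^ (n + (i + 1) + 1)))

lemma norm_taylorTerm_le_of_choose {n : ℕ} (hn : 0 < n) {F : En n → ℂ}
    (hF : AEStronglyMeasurable F (volume.restrict (ball 0 1)))
    (hF2 : IntegrableOn (fun w => ‖F w‖ ^ 2) (ball 0 1)) {ζ : En n} (hζ : ‖ζ‖ < 1)
    (v u : En n) (i : ℕ)
    (h : ((n + (i + 1)).choose (i + 1) : ℝ) * ((n + 2 * (i + 1)).choose (i + 1) : ℝ) ≤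
      ((n : ℝ) + 1) ^ (2 * (i + 1)))
    {s : ℝ} (hs : 0 < s) (hs2 : s ^ 2 = (1 - ‖ζ‖ ^ 2) ^ (n + 1)) :
    ‖taylorTerm F ζ v u i‖ ≤
      A2Norm 0 1 F / s * (((n : ℝ) + 1) / (1 - ‖ζ‖ ^ 2)) ^ (i + 1) * (‖v‖ ^ i * ‖u‖) := by
  set K : En n → ℂ := fun w =>
    (inner ℂ v w : ℂ) ^ i * inner ℂ u w * (1 / (1 - inner ℂ ζ w) ^ (n + (i + 1) + 1)) with hK
  have ha : 0 < 1 - ‖ζ‖ ^ 2 := by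
    have := pow_lt_one₀ (norm_nonneg ζ) hζ two_ne_zero
    linarith
  set a := 1 - ‖ζ‖ ^ 2 with hadef
  set C : ℝ := ((n + (i + 1)).choose (i + 1) : ℝ) with hC
  have hC0 : 0 ≤ C := Nat.cast_nonneg _
  have h1 : ‖unitBallMean fun w => F w * starRingEnd ℂ (K w)‖ ≤ A2Norm 0 1 F * A2Norm 0 1 K :=
    norm_unitBallMean_mul_conj_le hF hF2
      ((continuousOn_conj_kernel hζ v u i _).aestronglyMeasurable measurableSet_ball)
      (integrableOn_conj_kernel_sq hζ v u i _)
  have h2 : C * A2Norm 0 1 K ≤ (((n : ℝ) + 1) / a) ^ (i + 1) * (‖v‖ ^ i * ‖u‖) / s := by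
    refine (pow_le_pow_iff_left₀ (mul_nonneg hC0 (a2Norm_nonneg _ _ _)) (by positivity)
      two_ne_zero).1 ?_
    have h3 := mul_le_mul_of_nonneg_left (a2Norm_conj_kernel_sq_le hn hζ v u i) hC0
    calc (C * A2Norm 0 1 K) ^ 2 = C * (C * A2Norm 0 1 K ^ 2) := by ring
      _ ≤ C * (((n + 2 * (i + 1)).choose (i + 1) : ℝ) * (‖v‖ ^ (2 * i) * ‖u‖ ^ 2) *
          (1 / a ^ (n + 2 * (i + 1) + 1))) := h3
      _ = (C * ((n + 2 * (i + 1)).choose (i + 1) : ℝ)) * ((‖v‖ ^ (2 * i) * ‖u‖ ^ 2) *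
          (1 / a ^ (n + 2 * (i + 1) + 1))) := by ring
      _ ≤ ((n : ℝ) + 1) ^ (2 * (i + 1)) * ((‖v‖ ^ (2 * i) * ‖u‖ ^ 2) *
          (1 / a ^ (n + 2 * (i + 1) + 1))) := by gcongr
      _ = _ := by
        simp only [div_pow, mul_pow, hs2]
        field_simp
        ring
  rw [taylorTerm, norm_mul, Complex.norm_natCast]
  simp only [← conj_conj_kernel]
  calc _ ≤ C * (A2Norm 0 1 F * A2Norm 0 1 K) := by gcongr
    _ = A2Norm 0 1 F * (C * A2Norm 0 1 K) := by ring
    _ ≤ A2Norm 0 1 F * ((((n : ℝ) + 1) / a) ^ (i + 1) * (‖v‖ ^ i * ‖u‖) / s) :=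
      mul_le_mul_of_nonneg_left h2 (a2Norm_nonneg _ _ _)
    _ = _ := by ring

lemma hasDerivAt_second_line {n : ℕ} (hn : 0 < n) {F : En n → ℂ}
    (hF : DifferentiableOn ℂ F (ball 0 1)) (hFi : IntegrableOn F (ball 0 1))
    (x u : En n) (hx : ‖x‖ < 1) {g g' : ℂ → ℂ} {g'' : ℂ}
    (hg : ∀ᶠ s in nhds (0 : ℂ), F (x + s • u) = g s)
    (hg' : ∀ᶠ s in nhds (0 : ℂ), HasDerivAt g (g' s) s) (hg'' : HasDerivAt g' g'' 0) :
    ((n : ℂ) + 1) * ((n + 2) * unitBallMean fun w =>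
      F w * ((inner ℂ w u : ℂ) ^ 1 * inner ℂ w u * (1 / (1 - inner ℂ w x) ^ (n + 3)))) = g'' := by
  have hcont : Continuous fun s : ℂ => ‖x + s • u‖ := by fun_prop
  have hx0 : ‖x + (0 : ℂ) • u‖ < 1 := by simpa using hx
  have h1 : (fun s : ℂ => ((n : ℂ) + 1) * unitBallMean fun w =>
      (F w * inner ℂ w u) * (1 / (1 - inner ℂ w (x + s • u)) ^ (n + 2))) =ᶠ[nhds 0] g' := by
    filter_upwards [(isOpen_lt hcont continuous_const).mem_nhds hx0, hg.eventually_nhds, hg']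
      with s hs hs1 hs2
    exact (hasDerivAt_line hn hF hFi x u s hs).unique (hs2.congr_of_eventuallyEq hs1)
  have hFu : IntegrableOn (fun w => F w * inner ℂ w u) (ball 0 1) := by
    simpa using integrableOn_mul_kernel hFi (ζ := 0) (by simp) 0 u 0 0
  have h2 := (hasDerivAt_unitBallMean_kernel hFu x u 0 hx0 (n + 2)).const_mul ((n : ℂ) + 1)
  rw [← (h2.congr_of_eventuallyEq h1.symm).unique hg'']
  simp only [zero_smul, add_zero]
  push_cast
  congr 3
  ext w
  ring

lemma hasDerivAt_linear_pow_mul_inv_pow (α β V b s : ℂ) (hs : α - s * b ≠ 0) (p q : ℕ) :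
    HasDerivAt (fun s : ℂ => (β + s * V) ^ p * (1 / (α - s * b) ^ q))
      (p * V * ((β + s * V) ^ (p - 1) * (1 / (α - s * b) ^ q)) +
        q * b * ((β + s * V) ^ p * (1 / (α - s * b) ^ (q + 1)))) s := by
  have h1 : HasDerivAt (fun s : ℂ => β + s * V) V s := by
    simpa using ((hasDerivAt_id s).mul_const V).const_add β
  have h2 : HasDerivAt (fun s : ℂ => α - s * b) (-b) s := by
    simpa using ((hasDerivAt_id s).mul_const b).const_sub α
  have h3 := (h1.pow p).mul ((h2.pow q).inv (pow_ne_zero _ hs))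
  simp only [one_div]
  refine h3.congr_deriv ?_
  simp only [Pi.pow_apply, Pi.inv_apply]
  rcases q with _ | q
  · simp only [Nat.cast_zero, pow_zero, zero_mul, neg_zero, zero_div, mul_zero, add_zero, inv_one]
    ring
  · rw [Nat.add_sub_cancel]
    field_simp
    ring

lemma differentiable_inner_left {n : ℕ} (y : En n) : Differentiable ℂ fun w : En n =>
    (inner ℂ y w : ℂ) := (innerSL ℂ y).differentiable

lemma differentiableOn_conj_kernel_one {n : ℕ} {ζ : En n} (hζ : ‖ζ‖ < 1) (q : ℕ) :
    DifferentiableOn ℂ (fun w : En n => 1 / (1 - (inner ℂ ζ w : ℂ)) ^ q) (ball 0 1) := by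
  have hd : DifferentiableOn ℂ (fun w : En n => (1 - inner ℂ ζ w : ℂ) ^ q) (ball 0 1) :=
    (((differentiable_const 1).fun_sub (differentiable_inner_left ζ)).fun_pow q).differentiableOn
  simp only [one_div]
  refine hd.fun_inv fun w hw => ?_
  refine pow_ne_zero _ (sub_ne_zero.2 fun h => ?_)
  have := norm_inner_lt_one hζ (mem_ball_zero_iff.1 hw).le
  rw [← h, norm_one] at this
  exact lt_irrefl _ this

lemma differentiableOn_conj_kernel {n : ℕ} {ζ : En n} (hζ : ‖ζ‖ < 1) (v u : En n) (i q : ℕ) :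
    DifferentiableOn ℂ (fun w : En n => (inner ℂ v w : ℂ) ^ i * inner ℂ u w *
      (1 / (1 - inner ℂ ζ w) ^ q)) (ball 0 1) :=
  (((differentiable_inner_left v).fun_pow i).fun_mul
    (differentiable_inner_left u)).differentiableOn.fun_mul (differentiableOn_conj_kernel_one hζ q)

lemma norm_conj_kernel_one_le {n : ℕ} {ζ : En n} (hζ : ‖ζ‖ < 1) (q : ℕ) {w : En n}
    (hw : w ∈ ball (0 : En n) 1) :
    ‖1 / (1 - (inner ℂ ζ w : ℂ)) ^ q‖ ≤ 1 / (1 - ‖ζ‖) ^ q := by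
  have h1 : 1 - ‖ζ‖ ≤ ‖1 - (inner ℂ ζ w : ℂ)‖ := by
    have h2 := norm_sub_norm_le (1 : ℂ) (inner ℂ ζ w)
    rw [norm_one] at h2
    have := (norm_inner_le_norm (𝕜 := ℂ) ζ w).trans
      (mul_le_of_le_one_right (norm_nonneg _) (mem_ball_zero_iff.1 hw).le)
    linarith
  have h2 : 0 < 1 - ‖ζ‖ := by linarith
  rw [norm_div, norm_one, norm_pow]
  gcongr

lemma conj_conj_kernel_one {n : ℕ} (ζ w : En n) (q : ℕ) :
    starRingEnd ℂ (1 / (1 - (inner ℂ ζ w : ℂ)) ^ q) = 1 / (1 - inner ℂ w ζ) ^ q := by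
  simp only [map_pow, map_div₀, map_sub, map_one, inner_conj_symm]

lemma unitBallMean_mul_conj_self {n : ℕ} (G : En n → ℂ) :
    unitBallMean (fun w => G w * starRingEnd ℂ (G w)) = ((A2Norm 0 1 G ^ 2 : ℝ) : ℂ) := by
  simp only [Complex.mul_conj, Complex.normSq_eq_norm_sq]
  rw [unitBallMean, a2Norm_unit_sq, integral_complex_ofReal, Complex.ofReal_mul]

/-- The quadratic Bergman kernel derivative in direction `v`, corrected by a multiple of the kernel
itself so as to vanish at `ζ`. -/
def quadraticKernel (ζ v : En 2) (w : En 2) : ℂ :=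
  6 * ((inner ℂ v w : ℂ) ^ 1 * inner ℂ v w * (1 / (1 - inner ℂ ζ w) ^ 5)) -
    (6 * (inner ℂ v ζ : ℂ) ^ 2 / ((1 - ‖ζ‖ ^ 2 : ℝ) : ℂ) ^ 2) * (1 / (1 - (inner ℂ ζ w : ℂ)) ^ 3)

lemma continuousOn_quadraticKernel {ζ : En 2} (hζ : ‖ζ‖ < 1) (v : En 2) :
    ContinuousOn (quadraticKernel ζ v) (ball 0 1) :=
  (continuousOn_const.mul (differentiableOn_conj_kernel hζ v v 1 5).continuousOn).sub
    (continuousOn_const.mul (differentiableOn_conj_kernel_one hζ 3).continuousOn)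

lemma exists_norm_quadraticKernel_le {ζ : En 2} (hζ : ‖ζ‖ < 1) (v : En 2) :
    ∃ b, ∀ w ∈ ball (0 : En 2) 1, ‖quadraticKernel ζ v w‖ ≤ b := by
  refine ⟨‖(6 : ℂ)‖ * (‖v‖ ^ 1 * ‖v‖ * (1 / (1 - ‖ζ‖) ^ 5)) +
    ‖6 * (inner ℂ v ζ : ℂ) ^ 2 / ((1 - ‖ζ‖ ^ 2 : ℝ) : ℂ) ^ 2‖ * (1 / (1 - ‖ζ‖) ^ 3),
    fun w hw => ?_⟩
  refine (norm_sub_le _ _).trans ?_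
  rw [norm_mul, norm_mul (_ / _)]
  have h1 := norm_conj_kernel_le hζ v v 1 5 hw
  have h2 := norm_conj_kernel_one_le hζ 3 hw
  gcongr

lemma unitBallMean_mul_conj_quadraticKernel {ζ : En 2} (hζ : ‖ζ‖ < 1) (v : En 2) {F : En 2 → ℂ}
    (hF : DifferentiableOn ℂ F (ball 0 1)) (hFi : IntegrableOn F (ball 0 1)) (hFζ : F ζ = 0) :
    unitBallMean (fun w => F w * starRingEnd ℂ (quadraticKernel ζ v w)) = 6 * unitBallMean fun w =>
      F w * ((inner ℂ w v : ℂ) ^ 1 * inner ℂ w v * (1 / (1 - inner ℂ w ζ) ^ 5)) := by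
  have h0 := unitBallMean_kernel two_pos hF hFi hζ
  have hK := integrableOn_mul_kernel hFi hζ v v 1 5
  have hH : IntegrableOn (fun w => F w * (1 / (1 - (inner ℂ w ζ : ℂ)) ^ 3)) (ball 0 1) := by
    have : IntegrableOn (fun w => F w * starRingEnd ℂ (1 / (1 - (inner ℂ ζ w : ℂ)) ^ 3))
        (ball 0 1) := by
      refine Integrable.mul_bdd (c := 1 / (1 - ‖ζ‖) ^ 3) hFi
        ((Complex.continuous_conj.comp_continuousOn
          (differentiableOn_conj_kernel_one hζ 3).continuousOn).aestronglyMeasurable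
            measurableSet_ball) ?_
      filter_upwards [ae_restrict_mem measurableSet_ball] with w hw
      rw [RCLike.norm_conj]
      exact norm_conj_kernel_one_le hζ 3 hw
    simpa only [conj_conj_kernel_one] using this
  set c : ℂ := 6 * (inner ℂ v ζ : ℂ) ^ 2 / ((1 - ‖ζ‖ ^ 2 : ℝ) : ℂ) ^ 2 with hc
  have e : ∀ w, F w * starRingEnd ℂ (quadraticKernel ζ v w) =
      6 * (F w * ((inner ℂ w v : ℂ) ^ 1 * inner ℂ w v * (1 / (1 - inner ℂ w ζ) ^ 5))) -
        starRingEnd ℂ c * (F w * (1 / (1 - (inner ℂ w ζ : ℂ)) ^ 3)) := by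
    intro w
    rw [quadraticKernel, ← hc, map_sub, map_mul, map_mul _ c, conj_conj_kernel,
      conj_conj_kernel_one, map_ofNat]
    ring
  simp only [e]
  rw [hFζ, unitBallMean] at h0
  rw [unitBallMean, integral_sub (hK.const_mul _) (hH.const_mul _), integral_const_mul,
    integral_const_mul, mul_sub, mul_left_comm _ (starRingEnd ℂ c), h0, unitBallMean]
  ring

lemma a2Norm_quadraticKernel_sq {ζ : En 2} (hζ : ‖ζ‖ < 1) (v : En 2) :
    A2Norm 0 1 (quadraticKernel ζ v) ^ 2 = (6 * ‖v‖ ^ 4 * (1 - ‖ζ‖ ^ 2) ^ 2 +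
      60 * ‖(inner ℂ ζ v : ℂ)‖ ^ 2 * ‖v‖ ^ 2 * (1 - ‖ζ‖ ^ 2) + 54 * ‖(inner ℂ ζ v : ℂ)‖ ^ 4) /
        (1 - ‖ζ‖ ^ 2) ^ 7 := by
  have ha : 0 < 1 - ‖ζ‖ ^ 2 := by
    have := pow_lt_one₀ (norm_nonneg ζ) hζ two_ne_zero
    linarith
  set a : ℂ := ((1 - ‖ζ‖ ^ 2 : ℝ) : ℂ) with hadef
  have ha0 : a ≠ 0 := by rw [hadef]; exact_mod_cast ha.ne'
  set b : ℂ := inner ℂ ζ v with hb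
  set b' : ℂ := inner ℂ v ζ with hb'
  set V : ℂ := (‖v‖ : ℂ) ^ 2 with hV
  have hbb : b * b' = (‖b‖ : ℂ) ^ 2 := by
    rw [hb', ← inner_conj_symm v ζ, ← hb, Complex.mul_conj, Complex.normSq_eq_norm_sq]
    push_cast; rfl
  have hvv : (inner ℂ v v : ℂ) = V := inner_self_eq_norm_sq_to_K v
  have hζζ : (inner ℂ ζ ζ : ℂ) = 1 - a := by
    rw [hadef, inner_self_eq_norm_sq_to_K]; push_cast; simp
  have hG : DifferentiableOn ℂ (quadraticKernel ζ v) (ball 0 1) :=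
    ((differentiableOn_conj_kernel hζ v v 1 5).const_mul _).sub
      ((differentiableOn_conj_kernel_one hζ 3).const_mul _)
  obtain ⟨B, hB⟩ := exists_norm_quadraticKernel_le hζ v
  have hGi := integrableOn_ball_of_bounded (continuousOn_quadraticKernel hζ v) hB
  have hGζ : quadraticKernel ζ v ζ = 0 := by
    simp only [quadraticKernel, hζζ, ← hb', ← hadef]
    field_simp
    ring
  have h1 := unitBallMean_mul_conj_quadraticKernel hζ v hG hGi hGζ
  rw [unitBallMean_mul_conj_self] at h1
  have hev : ∀ᶠ s in nhds (0 : ℂ), a - s * b ≠ 0 := by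
    have : Continuous fun s : ℂ => a - s * b := by fun_prop
    exact this.continuousAt.eventually_ne (by simpa using ha0)
  set c : ℂ := 6 * b' ^ 2 / a ^ 2 with hc
  have h2 := hasDerivAt_second_line two_pos hG hGi ζ v hζ
    (g := fun s => 6 * ((b' + s * V) ^ 2 * (1 / (a - s * b) ^ 5)) -
      c * ((b' + s * V) ^ 0 * (1 / (a - s * b) ^ 3)))
    (g' := fun s => 6 * ((2 : ℕ) * V * ((b' + s * V) ^ 1 * (1 / (a - s * b) ^ 5)) +
        (5 : ℕ) * b * ((b' + s * V) ^ 2 * (1 / (a - s * b) ^ 6))) -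
      c * ((3 : ℕ) * b * ((b' + s * V) ^ 0 * (1 / (a - s * b) ^ 4))))
    (g'' := 2 * ((6 * V ^ 2 * a ^ 2 + 60 * (b * b') * V * a + 54 * (b * b') ^ 2) / a ^ 7))
    ?_ ?_ ?_
  · have h3 : ((A2Norm 0 1 (quadraticKernel ζ v) ^ 2 : ℝ) : ℂ) =
        (6 * V ^ 2 * a ^ 2 + 60 * (b * b') * V * a + 54 * (b * b') ^ 2) / a ^ 7 := by
      rw [h1]
      push_cast at h2
      linear_combination h2 / 2
    rw [hbb] at h3
    rw [hV, hadef] at h3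
    have h4 : (((6 * ‖v‖ ^ 4 * (1 - ‖ζ‖ ^ 2) ^ 2 + 60 * ‖b‖ ^ 2 * ‖v‖ ^ 2 * (1 - ‖ζ‖ ^ 2) +
        54 * ‖b‖ ^ 4) / (1 - ‖ζ‖ ^ 2) ^ 7 : ℝ) : ℂ) =
        ((A2Norm 0 1 (quadraticKernel ζ v) ^ 2 : ℝ) : ℂ) := by
      rw [h3]
      push_cast
      ring
    exact_mod_cast h4.symm
  · refine Filter.Eventually.of_forall fun s => ?_
    have e1 : (inner ℂ v (ζ + s • v) : ℂ) = b' + s * V := by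
      rw [inner_add_right, inner_smul_right, hvv]
    have e2 : 1 - (inner ℂ ζ (ζ + s • v) : ℂ) = a - s * b := by
      rw [inner_add_right, inner_smul_right, hζζ]; ring
    simp only [quadraticKernel, e1, e2, ← hc, ← hb', ← hadef]
    ring
  · filter_upwards [hev] with s hs
    refine (((hasDerivAt_linear_pow_mul_inv_pow a b' V b s hs 2 5).const_mul 6).sub
      ((hasDerivAt_linear_pow_mul_inv_pow a b' V b s hs 0 3).const_mul c)).congr_deriv ?_
    simp
  · have hs : a - 0 * b ≠ 0 := by simpa using ha0
    refine (((((hasDerivAt_linear_pow_mul_inv_pow a b' V b 0 hs 1 5).const_mul _).add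
      ((hasDerivAt_linear_pow_mul_inv_pow a b' V b 0 hs 2 6).const_mul _)).const_mul 6).sub
      (((hasDerivAt_linear_pow_mul_inv_pow a b' V b 0 hs 0 4).const_mul _).const_mul
        c)).congr_deriv ?_
    simp only [zero_mul, sub_zero, add_zero, hc]
    field_simp
    push_cast
    ring

lemma a2Norm_quadraticKernel_le {ζ : En 2} (hζ : ‖ζ‖ < 1) (v : En 2) {s : ℝ} (hs : 0 < s)
    (hs2 : s ^ 2 = (1 - ‖ζ‖ ^ 2) ^ 3) :
    A2Norm 0 1 (quadraticKernel ζ v) ≤ (3 / (1 - ‖ζ‖ ^ 2)) ^ 2 * ‖v‖ ^ 2 / s := by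
  have hz1 := pow_lt_one₀ (norm_nonneg ζ) hζ two_ne_zero
  have ha : 0 < 1 - ‖ζ‖ ^ 2 := by linarith
  refine (pow_le_pow_iff_left₀ (a2Norm_nonneg _ _ _) (by positivity) two_ne_zero).1 ?_
  rw [a2Norm_quadraticKernel_sq hζ v]
  have hb : ‖(inner ℂ ζ v : ℂ)‖ ^ 2 ≤ ‖ζ‖ ^ 2 * ‖v‖ ^ 2 := by
    rw [← mul_pow]
    have := norm_inner_le_norm (𝕜 := ℂ) ζ v
    gcongr
  set a := 1 - ‖ζ‖ ^ 2 with hadef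
  have hζa : ‖ζ‖ ^ 2 = 1 - a := by rw [hadef]; ring
  rw [hζa] at hb
  set B := ‖(inner ℂ ζ v : ℂ)‖ ^ 2 with hB
  have hB0 : 0 ≤ B := by positivity
  have hV0 : 0 ≤ ‖v‖ ^ 2 := by positivity
  have e : ‖(inner ℂ ζ v : ℂ)‖ ^ 4 = B ^ 2 := by rw [hB]; ring
  have e2 : ((3 / a) ^ 2 * ‖v‖ ^ 2 / s) ^ 2 = 81 * ‖v‖ ^ 4 / a ^ 7 := by
    simp only [div_pow, mul_pow, hs2]
    field_simp
    ring
  rw [e, e2]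
  have h1 : B ^ 2 ≤ ((1 - a) * ‖v‖ ^ 2) ^ 2 := by gcongr
  have h2 : B * ‖v‖ ^ 2 * a ≤ ((1 - a) * ‖v‖ ^ 2) * ‖v‖ ^ 2 * a := by gcongr
  have h3 : 0 ≤ ‖v‖ ^ 4 * a := by positivity
  have h4 : 0 ≤ ‖v‖ ^ 4 := by positivity
  gcongr
  nlinarith

lemma norm_taylorTerm_two_diag_le {F : En 2 → ℂ} (hF : DifferentiableOn ℂ F (ball 0 1))
    (hF2 : IntegrableOn (fun w => ‖F w‖ ^ 2) (ball 0 1)) {ζ : En 2} (hζ : ‖ζ‖ < 1)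
    (hFζ : F ζ = 0) (v : En 2) {s : ℝ} (hs : 0 < s) (hs2 : s ^ 2 = (1 - ‖ζ‖ ^ 2) ^ 3) :
    ‖taylorTerm F ζ v v 1‖ ≤ A2Norm 0 1 F / s * (3 / (1 - ‖ζ‖ ^ 2)) ^ 2 * ‖v‖ ^ 2 := by
  have hFm : AEStronglyMeasurable F (volume.restrict (ball 0 1)) :=
    hF.continuousOn.aestronglyMeasurable measurableSet_ball
  obtain ⟨B, hB⟩ := exists_norm_quadraticKernel_le hζ v
  have hGc := continuousOn_quadraticKernel hζ v
  have hG2 : IntegrableOn (fun w => ‖quadraticKernel ζ v w‖ ^ 2) (ball 0 1) := by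
    refine Integrable.mono' (g := fun _ => B ^ 2) (integrableOn_const measure_ball_lt_top.ne)
      ((hGc.norm.pow 2).aestronglyMeasurable measurableSet_ball) ?_
    filter_upwards [ae_restrict_mem measurableSet_ball] with w hw
    rw [norm_pow, norm_norm]
    have := hB w hw
    gcongr
  have e : taylorTerm F ζ v v 1 =
      unitBallMean fun w => F w * starRingEnd ℂ (quadraticKernel ζ v w) := by
    rw [unitBallMean_mul_conj_quadraticKernel hζ v hF (integrableOn_of_sq hFm hF2) hFζ, taylorTerm]
    norm_num [Nat.choose]
  rw [e]
  calc _ ≤ A2Norm 0 1 F * A2Norm 0 1 (quadraticKernel ζ v) :=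
        norm_unitBallMean_mul_conj_le hFm hF2 (hGc.aestronglyMeasurable measurableSet_ball) hG2
    _ ≤ A2Norm 0 1 F * ((3 / (1 - ‖ζ‖ ^ 2)) ^ 2 * ‖v‖ ^ 2 / s) :=
        mul_le_mul_of_nonneg_left (a2Norm_quadraticKernel_le hζ v hs hs2) (a2Norm_nonneg _ _ _)
    _ = _ := by ring

lemma taylorTerm_one_polarization {n : ℕ} {F : En n → ℂ} (hFi : IntegrableOn F (ball 0 1))
    {ζ : En n} (hζ : ‖ζ‖ < 1) (v u : En n) :
    4 * taylorTerm F ζ v u 1 = taylorTerm F ζ (v + u) (v + u) 1 -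
      taylorTerm F ζ (v - u) (v - u) 1 := by
  unfold taylorTerm unitBallMean
  rw [← mul_sub, ← mul_sub, ← integral_sub (integrableOn_mul_kernel hFi hζ _ _ _ _)
    (integrableOn_mul_kernel hFi hζ _ _ _ _), mul_left_comm, mul_left_comm (4 : ℂ),
    ← integral_const_mul]
  congr 3
  ext w
  rw [inner_add_right, inner_sub_right]
  ring

lemma taylorTerm_smul_smul {n : ℕ} (F : En n → ℂ) (ζ v u : En n) (i : ℕ) (c d : ℂ) :
    taylorTerm F ζ (c • v) (d • u) i = c ^ i * d * taylorTerm F ζ v u i := by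
  unfold taylorTerm unitBallMean
  rw [mul_left_comm (c ^ i * d), mul_left_comm (c ^ i * d),
    ← integral_const_mul (c ^ i * d)]
  congr 3
  ext w
  simp only [inner_smul_right]
  ring

lemma norm_taylorTerm_two_le {F : En 2 → ℂ} (hF : DifferentiableOn ℂ F (ball 0 1))
    (hF2 : IntegrableOn (fun w => ‖F w‖ ^ 2) (ball 0 1)) {ζ : En 2} (hζ : ‖ζ‖ < 1)
    (hFζ : F ζ = 0) (v u : En 2) {s : ℝ} (hs : 0 < s) (hs2 : s ^ 2 = (1 - ‖ζ‖ ^ 2) ^ 3) :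
    ‖taylorTerm F ζ v u 1‖ ≤
      A2Norm 0 1 F / s * (3 / (1 - ‖ζ‖ ^ 2)) ^ 2 * (‖v‖ * ‖u‖) := by
  have hFi := integrableOn_of_sq (hF.continuousOn.aestronglyMeasurable measurableSet_ball) hF2
  obtain ⟨v', hv', hv⟩ := exists_unit_smul_eq two_pos v
  obtain ⟨u', hu', hu⟩ := exists_unit_smul_eq two_pos u
  set M := A2Norm 0 1 F / s * (3 / (1 - ‖ζ‖ ^ 2)) ^ 2 with hM
  have h : ‖taylorTerm F ζ v' u' 1‖ ≤ M := by
    have h1 := norm_taylorTerm_two_diag_le hF hF2 hζ hFζ (v' + u') hs hs2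
    have h2 := norm_taylorTerm_two_diag_le hF hF2 hζ hFζ (v' - u') hs hs2
    have h3 := congrArg norm (taylorTerm_one_polarization hFi hζ v' u')
    have h4 := norm_sub_le (taylorTerm F ζ (v' + u') (v' + u') 1)
      (taylorTerm F ζ (v' - u') (v' - u') 1)
    have h5 := parallelogram_law_with_norm ℂ v' u'
    rw [norm_mul] at h3
    norm_num at h3
    rw [← hM] at h1 h2
    rw [hv', hu'] at h5
    have h6 : M * ‖v' + u'‖ ^ 2 + M * ‖v' - u'‖ ^ 2 = M * 4 := by
      rw [← mul_add]; congr 1; linarith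
    linarith
  rw [hv, hu, taylorTerm_smul_smul, norm_mul, norm_mul, norm_pow, Complex.norm_real,
    Complex.norm_real, norm_norm, norm_norm, norm_smul, norm_smul, hv', hu', Complex.norm_real,
    Complex.norm_real, norm_norm, norm_norm, pow_one, mul_one, mul_one, mul_comm M]
  gcongr

lemma norm_taylorTerm_le {n : ℕ} (hn : 2 ≤ n) {F : En n → ℂ}
    (hF : DifferentiableOn ℂ F (ball 0 1))
    (hF2 : IntegrableOn (fun w => ‖F w‖ ^ 2) (ball 0 1)) {ζ : En n} (hζ : ‖ζ‖ < 1)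
    (hFζ : F ζ = 0) (v u : En n) {i : ℕ} (hi : 1 ≤ i) {s : ℝ} (hs : 0 < s)
    (hs2 : s ^ 2 = (1 - ‖ζ‖ ^ 2) ^ (n + 1)) :
    ‖taylorTerm F ζ v u i‖ ≤
      A2Norm 0 1 F / s * (((n : ℝ) + 1) / (1 - ‖ζ‖ ^ 2)) ^ (i + 1) * (‖v‖ ^ i * ‖u‖) := by
  by_cases h : n = 2 ∧ i = 1
  · obtain ⟨rfl, rfl⟩ := h
    have := norm_taylorTerm_two_le hF hF2 hζ hFζ v u hs hs2
    norm_num at this ⊢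
    exact this
  · exact norm_taylorTerm_le_of_choose (by omega)
      (hF.continuousOn.aestronglyMeasurable measurableSet_ball) hF2 hζ v u i
      (choose_mul_choose_le (by omega)) hs hs2

lemma hasSum_unitBallMean_kernel_add {n : ℕ} {H : En n → ℂ} (hH : IntegrableOn H (ball 0 1))
    {ζ v : En n} (hv : ‖v‖ < 1 - ‖ζ‖) (q : ℕ) :
    HasSum (fun i => ((i + q).choose q : ℂ) * unitBallMean fun w =>
        H w * ((inner ℂ w v : ℂ) ^ i * (1 / (1 - inner ℂ w ζ) ^ (q + 1 + i))))
      (unitBallMean fun w => H w * (1 / (1 - inner ℂ w (ζ + v)) ^ (q + 1))) := by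
  have hd : 0 < 1 - ‖ζ‖ := (norm_nonneg v).trans_lt hv
  have hζ : ‖ζ‖ < 1 := by linarith
  set r := ‖v‖ / (1 - ‖ζ‖) with hr
  have hr0 : 0 ≤ r := by positivity
  have hr1 : r < 1 := (div_lt_one hd).2 hv
  have hx : ∀ w ∈ ball (0 : En n) 1, ‖(inner ℂ w v : ℂ) / (1 - inner ℂ w ζ)‖ ≤ r := by
    intro w hw
    have hw1 := (mem_ball_zero_iff.1 hw).le
    have h1 := one_sub_norm_le_norm_one_sub_inner (z := ζ) hw1
    have h2 := (norm_inner_le_norm (𝕜 := ℂ) w v).trans (mul_le_of_le_one_left (norm_nonneg _) hw1)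
    rw [norm_div, hr]
    gcongr
  have hkc : ∀ p : ℕ, ContinuousOn (fun w : En n => 1 / (1 - (inner ℂ w ζ : ℂ)) ^ p) (ball 0 1) :=
    continuousOn_kernel_pow hζ
  set T : ℕ → En n → ℂ := fun i w => ((i + q).choose q : ℂ) *
    (H w * ((inner ℂ w v : ℂ) ^ i * (1 / (1 - inner ℂ w ζ) ^ (q + 1 + i)))) with hT
  have hTb : ∀ i, ∀ w ∈ ball (0 : En n) 1, ‖T i w‖ ≤
      ‖H w‖ * (((i + q).choose q : ℝ) * r ^ i * (1 / (1 - ‖ζ‖) ^ (q + 1))) := by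
    intro i w hw
    have e : T i w = H w * (((i + q).choose q : ℂ) * ((inner ℂ w v : ℂ) / (1 - inner ℂ w ζ)) ^ i *
        (1 / (1 - inner ℂ w ζ) ^ (q + 1))) := by
      have := one_sub_inner_ne_zero (mem_ball_zero_iff.1 hw).le hζ
      simp only [hT]
      rw [div_pow]
      field_simp
      ring
    have h1 := one_sub_norm_le_norm_one_sub_inner (z := ζ) (mem_ball_zero_iff.1 hw).le
    rw [e, norm_mul, norm_mul, norm_mul, norm_pow, Complex.norm_natCast, norm_div 1, norm_one,
      norm_pow]
    have h2 := hx w hw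
    gcongr
  have hTi : ∀ i, IntegrableOn (T i) (ball 0 1) := by
    intro i
    refine Integrable.mono' (hH.norm.mul_const _) ?_
      ((ae_restrict_mem measurableSet_ball).mono fun w hw => hTb i w hw)
    refine (hH.aestronglyMeasurable.mul (ContinuousOn.aestronglyMeasurable
      (ContinuousOn.mul (Continuous.continuousOn (by fun_prop)) (hkc _))
        measurableSet_ball)).const_mul _
  have hsum : Summable fun i => ∫ w in ball (0 : En n) 1, ‖T i w‖ := by
    have hs : Summable fun i => ((i + q).choose q : ℝ) * r ^ i :=
      (hasSum_choose_mul_geometric_of_norm_lt_one q (r := r)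
        (by rwa [Real.norm_of_nonneg hr0])).summable
    refine Summable.of_nonneg_of_le (fun i => integral_nonneg fun w => norm_nonneg _) (fun i => ?_)
      ((hs.mul_right (1 / (1 - ‖ζ‖) ^ (q + 1))).mul_left (∫ w in ball (0 : En n) 1, ‖H w‖))
    rw [← integral_mul_const]
    exact setIntegral_mono_on (hTi i).norm (hH.norm.mul_const _) measurableSet_ball (hTb i)
  have h := hasSum_integral_of_summable_integral_norm hTi hsum
  have h2 : ∀ w ∈ ball (0 : En n) 1, ∑' i, T i w =
      H w * (1 / (1 - inner ℂ w (ζ + v)) ^ (q + 1)) := by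
    intro w hw
    have hne := one_sub_inner_ne_zero (mem_ball_zero_iff.1 hw).le hζ
    have h3 := ((hasSum_choose_mul_geometric_of_norm_lt_one q
      ((hx w hw).trans_lt hr1)).mul_left (1 / (1 - (inner ℂ w ζ : ℂ)) ^ (q + 1))).mul_left (H w)
    have h4 : HasSum (fun i => T i w) _ := h3.congr_fun fun i => by
      simp only [hT]
      rw [div_pow]
      field_simp
      ring
    have h5 : (1 - (inner ℂ w ζ : ℂ)) * (1 - inner ℂ w v / (1 - inner ℂ w ζ)) =
        1 - inner ℂ w (ζ + v) := by
      rw [inner_add_right]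
      field_simp
      ring
    rw [h4.tsum_eq, one_div_mul_one_div, ← mul_pow, h5]
  rw [setIntegral_congr_fun measurableSet_ball h2] at h
  refine (h.mul_left ((n.factorial / Real.pi ^ n : ℝ) : ℂ)).congr_fun fun i => ?_
  simp only [hT, unitBallMean]
  rw [integral_const_mul, mul_left_comm]

lemma hasSum_taylorTerm {n : ℕ} (hn : 0 < n) {F : En n → ℂ}
    (hF : DifferentiableOn ℂ F (ball 0 1)) (hFi : IntegrableOn F (ball 0 1))
    {ζ v : En n} (hv : ‖v‖ < 1 - ‖ζ‖) (hFζ : F ζ = 0) :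
    HasSum (fun i => taylorTerm F ζ v v i) (F (ζ + v)) := by
  have hζv : ‖ζ + v‖ < 1 := (norm_add_le _ _).trans_lt (by linarith)
  have hζ : ‖ζ‖ < 1 := by linarith [norm_nonneg v]
  have h := hasSum_unitBallMean_kernel_add hFi hv n
  rw [unitBallMean_kernel hn hF hFi hζv, ← hasSum_nat_add_iff' 1] at h
  have h0 := unitBallMean_kernel hn hF hFi hζ
  rw [hFζ] at h0
  simp only [Finset.sum_range_one, pow_zero, one_mul, add_zero, h0, mul_zero, sub_zero] at h
  refine h.congr_fun fun i => ?_
  rw [taylorTerm, Nat.choose_symm_add.symm, add_comm (i + 1) n]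
  congr 2
  ext w
  rw [show n + 1 + (i + 1) = n + (i + 1) + 1 by ring]
  ring

lemma hasSum_fderiv_taylorTerm {n : ℕ} (hn : 0 < n) {F : En n → ℂ}
    (hF : DifferentiableOn ℂ F (ball 0 1)) (hFi : IntegrableOn F (ball 0 1))
    {ζ v : En n} (hv : ‖v‖ < 1 - ‖ζ‖) (u : En n) :
    HasSum (fun i : ℕ => ((i : ℂ) + 1) * taylorTerm F ζ v u i) (fderiv ℂ F (ζ + v) u) := by
  have hζv : ‖ζ + v‖ < 1 := (norm_add_le _ _).trans_lt (by linarith)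
  have hζ : ‖ζ‖ < 1 := by linarith [norm_nonneg v]
  have hFu : IntegrableOn (fun w => F w * inner ℂ w u) (ball 0 1) := by
    simpa using integrableOn_mul_kernel hFi (ζ := 0) (by simp) 0 u 0 0
  have h := (hasSum_unitBallMean_kernel_add hFu hv (n + 1)).mul_left ((n : ℂ) + 1)
  rw [← fderiv_eq_unitBallMean hn hF hFi u hζv] at h
  refine h.congr_fun fun i => ?_
  have e : ((i : ℂ) + 1) * ((n + (i + 1)).choose (i + 1) : ℂ) =
      ((n : ℂ) + 1) * ((i + (n + 1)).choose (n + 1) : ℂ) := by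
    rw [Nat.choose_symm_add.symm, Nat.cast_add_choose ℂ, Nat.choose_symm_add.symm,
      Nat.cast_add_choose ℂ, Nat.factorial_succ, Nat.factorial_succ,
      show i + (n + 1) = n + (i + 1) by ring]
    have p1 : (n.factorial : ℂ) ≠ 0 := by exact_mod_cast n.factorial_ne_zero
    have p2 : (i.factorial : ℂ) ≠ 0 := by exact_mod_cast i.factorial_ne_zero
    have p3 : (i : ℂ) + 1 ≠ 0 := by exact_mod_cast i.succ_ne_zero
    have p4 : (n : ℂ) + 1 ≠ 0 := by exact_mod_cast n.succ_ne_zero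
    push_cast
    field_simp
  rw [taylorTerm, ← mul_assoc, e, mul_assoc]
  congr 3
  ext w
  rw [show n + 1 + 1 + i = n + (i + 1) + 1 by ring]
  ring

lemma norm_lt_one_sub_norm_of_mul_lt {n : ℕ} (hn : 2 ≤ n) {ζ v : En n} (hζ : ‖ζ‖ < 1)
    (hv : ((n : ℝ) + 1) / (1 - ‖ζ‖ ^ 2) * ‖v‖ < 1) : ‖v‖ < 1 - ‖ζ‖ := by
  have ha : 0 < 1 - ‖ζ‖ ^ 2 := by
    have := pow_lt_one₀ (norm_nonneg ζ) hζ two_ne_zero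
    linarith
  have hn' : (2 : ℝ) ≤ n := by exact_mod_cast hn
  rw [div_mul_eq_mul_div, div_lt_one ha] at hv
  nlinarith [norm_nonneg v, norm_nonneg ζ]

lemma norm_fderiv_apply_sub_le {n : ℕ} (hn : 2 ≤ n) {F : En n → ℂ}
    (hF : DifferentiableOn ℂ F (ball 0 1))
    (hF2 : IntegrableOn (fun w => ‖F w‖ ^ 2) (ball 0 1)) {ζ v : En n} (hζ : ‖ζ‖ < 1)
    (hFζ : F ζ = 0) {s : ℝ} (hs : 0 < s) (hs2 : s ^ 2 = (1 - ‖ζ‖ ^ 2) ^ (n + 1))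
    {τ : ℝ} (hτ : ((n : ℝ) + 1) / (1 - ‖ζ‖ ^ 2) * ‖v‖ = τ) (hτ1 : τ < 1) :
    ‖fderiv ℂ F (ζ + v) v - F (ζ + v)‖ ≤ A2Norm 0 1 F / s * (τ ^ 2 / (1 - τ) ^ 2) := by
  have hFi := integrableOn_of_sq (hF.continuousOn.aestronglyMeasurable measurableSet_ball) hF2
  have ha : 0 < 1 - ‖ζ‖ ^ 2 := by
    have := pow_lt_one₀ (norm_nonneg ζ) hζ two_ne_zero
    linarith
  have hτ0 : 0 ≤ τ := by rw [← hτ]; positivity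
  have hv := norm_lt_one_sub_norm_of_mul_lt hn hζ (v := v) (by rwa [hτ])
  have h := (hasSum_fderiv_taylorTerm (by omega) hF hFi hv v).sub
    (hasSum_taylorTerm (by omega) hF hFi hv hFζ)
  have hg := ((hasSum_coe_mul_geometric_of_norm_lt_one (r := τ)
    (by rwa [Real.norm_of_nonneg hτ0])).mul_left τ).mul_left (A2Norm 0 1 F / s)
  refine (h.norm_le_of_bounded hg fun i => ?_).trans (le_of_eq (by ring))
  have e : ((i : ℂ) + 1) * taylorTerm F ζ v v i - taylorTerm F ζ v v i =
      i * taylorTerm F ζ v v i := by ring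
  rw [e, norm_mul, Complex.norm_natCast]
  rcases Nat.eq_zero_or_pos i with rfl | hi
  · simp
  · have hb := norm_taylorTerm_le hn hF hF2 hζ hFζ v v hi hs hs2
    calc _ ≤ (i : ℝ) * (A2Norm 0 1 F / s * (((n : ℝ) + 1) / (1 - ‖ζ‖ ^ 2)) ^ (i + 1) *
          (‖v‖ ^ i * ‖v‖)) := by gcongr
      _ = _ := by
        rw [← hτ]
        generalize ((n : ℝ) + 1) / (1 - ‖ζ‖ ^ 2) = m
        ring

lemma norm_fderiv_sub_fderiv_apply_le {n : ℕ} (hn : 2 ≤ n) {F : En n → ℂ}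
    (hF : DifferentiableOn ℂ F (ball 0 1))
    (hF2 : IntegrableOn (fun w => ‖F w‖ ^ 2) (ball 0 1)) {ζ v : En n} (u : En n) (hζ : ‖ζ‖ < 1)
    (hFζ : F ζ = 0) {s : ℝ} (hs : 0 < s) (hs2 : s ^ 2 = (1 - ‖ζ‖ ^ 2) ^ (n + 1))
    {τ : ℝ} (hτ : ((n : ℝ) + 1) / (1 - ‖ζ‖ ^ 2) * ‖v‖ = τ) (hτ1 : τ < 1) :
    ‖fderiv ℂ F (ζ + v) u - fderiv ℂ F ζ u‖ ≤
      A2Norm 0 1 F / s * (((n : ℝ) + 1) / (1 - ‖ζ‖ ^ 2)) * (1 / (1 - τ) ^ 2 - 1) * ‖u‖ := by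
  have hFi := integrableOn_of_sq (hF.continuousOn.aestronglyMeasurable measurableSet_ball) hF2
  have ha : 0 < 1 - ‖ζ‖ ^ 2 := by
    have := pow_lt_one₀ (norm_nonneg ζ) hζ two_ne_zero
    linarith
  have hτ0 : 0 ≤ τ := by rw [← hτ]; positivity
  have hv := norm_lt_one_sub_norm_of_mul_lt hn hζ (v := v) (by rwa [hτ])
  have h := hasSum_fderiv_taylorTerm (by omega) hF hFi hv u
  have h0 := hasSum_fderiv_taylorTerm (by omega) hF hFi (v := (0 : En n)) (by simpa using hζ) u
  have h00 : fderiv ℂ F ζ u = taylorTerm F ζ v u 0 := by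
    rw [add_zero] at h0
    refine h0.unique ?_
    have := hasSum_single (f := fun i : ℕ => ((i : ℂ) + 1) * taylorTerm F ζ 0 u i) 0 fun i hi => by
      have := taylorTerm_smul_smul F ζ 0 u i 0 1
      rw [zero_smul, one_smul, zero_pow hi, zero_mul, zero_mul] at this
      simp [this]
    have e : taylorTerm F ζ 0 u 0 = taylorTerm F ζ v u 0 := by simp [taylorTerm]
    simpa [e] using this
  rw [← hasSum_nat_add_iff' 1] at h
  simp only [Finset.sum_range_one, Nat.cast_zero, zero_add, one_mul] at h
  have hg : HasSum (fun i : ℕ => ((i : ℝ) + 1) * τ ^ i) (1 / (1 - τ) ^ 2) := by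
    have := hasSum_choose_mul_geometric_of_norm_lt_one 1 (r := τ)
      (by rwa [Real.norm_of_nonneg hτ0])
    simpa using this
  rw [← hasSum_nat_add_iff' 1] at hg
  simp only [Finset.sum_range_one, Nat.cast_zero, zero_add, one_mul, pow_zero] at hg
  rw [h00]
  refine h.norm_le_of_bounded
    ((hg.mul_left (A2Norm 0 1 F / s * (((n : ℝ) + 1) / (1 - ‖ζ‖ ^ 2)))).mul_right ‖u‖) fun i => ?_
  have hb := norm_taylorTerm_le hn hF hF2 hζ hFζ v u (i := i + 1) (by omega) hs hs2
  rw [norm_mul]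
  have e : ‖((i + 1 : ℕ) : ℂ) + 1‖ = ((i + 1 : ℕ) : ℝ) + 1 := by
    rw [← Nat.cast_add_one, Complex.norm_natCast]; push_cast; ring
  rw [e]
  calc _ ≤ (((i + 1 : ℕ) : ℝ) + 1) * (A2Norm 0 1 F / s *
        (((n : ℝ) + 1) / (1 - ‖ζ‖ ^ 2)) ^ (i + 1 + 1) * (‖v‖ ^ (i + 1) * ‖u‖)) := by gcongr
    _ = _ := by
      rw [← hτ]
      generalize ((n : ℝ) + 1) / (1 - ‖ζ‖ ^ 2) = m
      ring

lemma add_smul_mem_ball_iff {n : ℕ} (ω w : En n) {R : ℝ} (hR : 0 < R) :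
    ω + (R : ℂ) • w ∈ ball ω R ↔ w ∈ ball (0 : En n) 1 := by
  rw [mem_ball_iff_norm, add_sub_cancel_left, norm_smul, Complex.norm_of_nonneg hR.le,
    mem_ball_zero_iff, mul_lt_iff_lt_one_right hR]

lemma indicator_ball_comp_affine {n : ℕ} (ω : En n) {R : ℝ} (hR : 0 < R) (g : En n → ℝ) :
    (fun w => (ball ω R).indicator g (ω + (R : ℂ) • w)) =
      (ball (0 : En n) 1).indicator fun w => g (ω + (R : ℂ) • w) := by
  ext w
  by_cases hw : w ∈ ball (0 : En n) 1
  · rw [Set.indicator_of_mem hw, Set.indicator_of_mem ((add_smul_mem_ball_iff ω w hR).2 hw)]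
  · rw [Set.indicator_of_notMem hw,
      Set.indicator_of_notMem (mt (add_smul_mem_ball_iff ω w hR).1 hw)]

lemma integrableOn_ball_comp_affine {n : ℕ} (ω : En n) {R : ℝ} (hR : 0 < R) {g : En n → ℝ}
    (hg : IntegrableOn g (ball ω R)) :
    IntegrableOn (fun w => g (ω + (R : ℂ) • w)) (ball 0 1) := by
  rw [← integrable_indicator_iff measurableSet_ball] at hg ⊢
  rw [← indicator_ball_comp_affine ω hR]
  exact (hg.comp_add_left ω).comp_smul (R := R) hR.ne'

lemma setIntegral_ball_comp_affine {n : ℕ} (ω : En n) {R : ℝ} (hR : 0 < R) (g : En n → ℝ) :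
    ∫ w in ball (0 : En n) 1, g (ω + (R : ℂ) • w) =
      (R ^ (2 * n))⁻¹ * ∫ z in ball ω R, g z := by
  have hd : Module.finrank ℝ (En n) = 2 * n := by
    rw [← Module.finrank_mul_finrank ℝ ℂ (En n), Complex.finrank_real_complex,
      finrank_euclideanSpace_fin]
  rw [← integral_indicator measurableSet_ball, ← integral_indicator measurableSet_ball,
    ← indicator_ball_comp_affine ω hR]
  have := Measure.integral_comp_smul_of_nonneg (μ := (volume : Measure (En n)))
    (fun z => (ball ω R).indicator g (ω + z)) R (hR := hR.le)
  rw [hd, integral_add_left_eq_self, smul_eq_mul] at this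
  exact this

lemma a2Norm_comp_affine {𝓕 : Type*} [NormedAddCommGroup 𝓕] {n : ℕ} (ω : En n) {R : ℝ}
    (hR : 0 < R) (f : En n → 𝓕) :
    A2Norm 0 1 (fun w => f (ω + (R : ℂ) • w)) = A2Norm ω R f := by
  have := setIntegral_ball_comp_affine ω hR fun z => ‖f z‖ ^ 2
  rw [A2Norm, A2Norm, this]
  congr 1
  field_simp
  simp

lemma a2Norm_unit_inner_le {n m : ℕ} {g : En n → En m}
    (hg : ContinuousOn g (ball 0 1))
    (hg2 : IntegrableOn (fun w => ‖g w‖ ^ 2) (ball 0 1)) (e : En m) :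
    IntegrableOn (fun w => ‖(inner ℂ e (g w) : ℂ)‖ ^ 2) (ball 0 1) ∧
      A2Norm 0 1 (fun w => (inner ℂ e (g w) : ℂ)) ≤ ‖e‖ * A2Norm 0 1 g := by
  have hle : ∀ w, ‖(inner ℂ e (g w) : ℂ)‖ ^ 2 ≤ ‖e‖ ^ 2 * ‖g w‖ ^ 2 := fun w => by
    rw [← mul_pow]
    exact pow_le_pow_left₀ (norm_nonneg _) (norm_inner_le_norm _ _) 2
  have hi : IntegrableOn (fun w => ‖(inner ℂ e (g w) : ℂ)‖ ^ 2) (ball 0 1) := by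
    refine Integrable.mono' (hg2.const_mul (‖e‖ ^ 2)) ?_ (.of_forall fun w => ?_)
    · exact (ContinuousOn.pow (continuousOn_const.inner hg).norm 2).aestronglyMeasurable
        measurableSet_ball
    · rw [Real.norm_of_nonneg (by positivity)]
      exact hle w
  refine ⟨hi, (sq_le_sq₀ (a2Norm_nonneg _ _ _)
    (mul_nonneg (norm_nonneg _) (a2Norm_nonneg _ _ _))).1 ?_⟩
  rw [mul_pow, a2Norm_unit_sq, a2Norm_unit_sq, mul_left_comm, ← integral_const_mul (‖e‖ ^ 2)]
  exact mul_le_mul_of_nonneg_left (integral_mono hi (hg2.const_mul _) hle) (by positivity)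

lemma norm_le_of_forall_norm_inner_le {m : ℕ} {X : En m} {C : ℝ} (hC : 0 ≤ C)
    (h : ∀ e : En m, ‖(inner ℂ e X : ℂ)‖ ≤ ‖e‖ * C) : ‖X‖ ≤ C := by
  rcases (norm_nonneg X).eq_or_lt with h0 | h0
  · rwa [← h0]
  · have := h X
    rw [inner_self_eq_norm_sq_to_K, norm_pow, RCLike.norm_ofReal, abs_norm, sq] at this
    exact le_of_mul_le_mul_left this h0

lemma fderiv_inner_comp_affine {n m : ℕ} {f : En n → En m} {ω w : En n} {R : ℝ}
    (hf : DifferentiableAt ℂ f (ω + (R : ℂ) • w)) (e : En m) (u : En n) :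
    fderiv ℂ (fun w => (inner ℂ e (f (ω + (R : ℂ) • w)) : ℂ)) w u =
      inner ℂ e (fderiv ℂ f (ω + (R : ℂ) • w) ((R : ℂ) • u)) := by
  have hg : HasFDerivAt (fun w : En n => ω + (R : ℂ) • w)
      ((R : ℂ) • ContinuousLinearMap.id ℂ (En n)) w :=
    ((hasFDerivAt_id w).const_smul (R : ℂ)).const_add ω
  have := (innerSL ℂ e).hasFDerivAt.comp w (hf.hasFDerivAt.comp w hg)
  have h2 : HasFDerivAt (fun w => (inner ℂ e (f (ω + (R : ℂ) • w)) : ℂ)) _ w := this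
  rw [h2.fderiv]
  simp

theorem MemA2.norm_fderiv_estimates {n m : ℕ} (hn : 2 ≤ n) {ω : En n} {R : ℝ} (hR : 0 < R)
    {f : En n → En m} (hf : MemA2 ω R f) {ζ x : En n} (hζ : ζ ∈ ball ω R) (hfζ : f ζ = 0)
    {s : ℝ} (hs : 0 < s) (hs2 : s ^ 2 = (1 - (‖ζ - ω‖ / R) ^ 2) ^ (n + 1)) {M τ : ℝ}
    (hM : M = ((n : ℝ) + 1) / (R * (1 - (‖ζ - ω‖ / R) ^ 2)))
    (hτ : M * ‖x - ζ‖ = τ) (hτ1 : τ < 1) :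
    ‖fderiv ℂ f x (x - ζ) - f x‖ ≤ A2Norm ω R f / s * (τ ^ 2 / (1 - τ) ^ 2) ∧
      ‖fderiv ℂ f x - fderiv ℂ f ζ‖ ≤ A2Norm ω R f / s * M * (1 / (1 - τ) ^ 2 - 1) := by
  have hR' : (R : ℂ) ≠ 0 := by exact_mod_cast hR.ne'
  set z : En n := (R : ℂ)⁻¹ • (ζ - ω) with hz
  have hnorm : ∀ y : En n, ‖(R : ℂ)⁻¹ • y‖ = ‖y‖ / R := fun y => by
    rw [norm_smul, norm_inv, Complex.norm_of_nonneg hR.le, inv_mul_eq_div]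
  have hzn : ‖z‖ = ‖ζ - ω‖ / R := hnorm _
  have hz1 : ‖z‖ < 1 := by
    rw [hzn, div_lt_one hR]
    exact mem_ball_iff_norm.1 hζ
  have ha : 0 < 1 - ‖z‖ ^ 2 := by
    have := pow_lt_one₀ (norm_nonneg z) hz1 two_ne_zero
    linarith
  set g : En n → En m := fun w => f (ω + (R : ℂ) • w) with hg
  have hmaps : ∀ w ∈ ball (0 : En n) 1, ω + (R : ℂ) • w ∈ ball ω R := fun w =>
    (add_smul_mem_ball_iff ω w hR).2
  have hgd : DifferentiableOn ℂ g (ball 0 1) :=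
    hf.1.differentiableOn.comp (Differentiable.differentiableOn (by fun_prop)) hmaps
  have hg2 : IntegrableOn (fun w => ‖g w‖ ^ 2) (ball 0 1) :=
    integrableOn_ball_comp_affine ω hR hf.2
  have hzz : ω + (R : ℂ) • z = ζ := by rw [hz, smul_inv_smul₀ hR']; abel
  have hg0 : g z = 0 := by simp only [hg, hzz, hfζ]
  set v : En n := (R : ℂ)⁻¹ • (x - ζ) with hv
  have hRv : (R : ℂ) • v = x - ζ := by rw [hv, smul_inv_smul₀ hR']
  have hx : ω + (R : ℂ) • (z + v) = x := by rw [smul_add, ← add_assoc, hzz, hRv]; abel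
  have hMR : ((n : ℝ) + 1) / (1 - ‖z‖ ^ 2) = M * R := by
    rw [hM, hzn]
    field_simp
  have hτ' : ((n : ℝ) + 1) / (1 - ‖z‖ ^ 2) * ‖v‖ = τ := by
    rw [hMR, hv, hnorm, ← hτ]
    field_simp
  have hM0 : 0 ≤ M := by rw [hM, ← hzn]; positivity
  have hτ0 : 0 ≤ τ := by rw [← hτ]; positivity
  have hN := a2Norm_nonneg ω R f
  have hvz : ‖z + v‖ < 1 := by
    have := norm_lt_one_sub_norm_of_mul_lt hn hz1 (v := v) (by rwa [hτ'])
    linarith [norm_add_le z v]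
  have hdiff : ∀ w : En n, ‖w‖ < 1 → DifferentiableAt ℂ f (ω + (R : ℂ) • w) := fun w hw =>
    (hf.1 _ (hmaps w (mem_ball_zero_iff.2 hw))).differentiableAt
  rw [← hzn] at hs2
  have hcoef : 0 ≤ 1 / (1 - τ) ^ 2 - 1 := by
    rw [sub_nonneg, le_div_iff₀ (by nlinarith)]
    nlinarith
  constructor
  · refine norm_le_of_forall_norm_inner_le (by positivity) fun e => ?_
    obtain ⟨hF2, hFN⟩ := a2Norm_unit_inner_le hgd.continuousOn hg2 e
    rw [a2Norm_comp_affine ω hR f] at hFN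
    have h := norm_fderiv_apply_sub_le hn (F := fun w => (inner ℂ e (g w) : ℂ))
      ((innerSL ℂ e).differentiable.comp_differentiableOn hgd) hF2 hz1
      (by simp only [hg0, inner_zero_right]) hs hs2 hτ' hτ1
    rw [fderiv_inner_comp_affine (hdiff _ hvz), hx, hRv] at h
    simp only [hg, hx] at h
    rw [inner_sub_right]
    refine h.trans ?_
    rw [← mul_assoc, ← mul_div_assoc ‖e‖]
    gcongr
  · refine ContinuousLinearMap.opNorm_le_bound _ (by positivity) fun u => ?_
    refine norm_le_of_forall_norm_inner_le (by positivity) fun e => ?_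
    obtain ⟨hF2, hFN⟩ := a2Norm_unit_inner_le hgd.continuousOn hg2 e
    rw [a2Norm_comp_affine ω hR f] at hFN
    have h := norm_fderiv_sub_fderiv_apply_le hn (F := fun w => (inner ℂ e (g w) : ℂ))
      ((innerSL ℂ e).differentiable.comp_differentiableOn hgd) hF2 ((R : ℂ)⁻¹ • u) hz1
      (by simp only [hg0, inner_zero_right]) hs hs2 hτ' hτ1
    rw [fderiv_inner_comp_affine (hdiff _ hvz), fderiv_inner_comp_affine (hdiff _ hz1), hx, hzz,
      smul_inv_smul₀ hR', hMR, hnorm] at h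
    rw [sub_apply, inner_sub_right]
    refine h.trans ?_
    calc _ ≤ ‖e‖ * A2Norm ω R f / s * (M * R) * (1 / (1 - τ) ^ 2 - 1) * (‖u‖ / R) := by gcongr
      _ = _ := by field_simp

lemma ContinuousLinearEquiv.exists_eq_of_norm_symm_mul_lt {E : Type*} [NormedAddCommGroup E]
    [NormedSpace ℂ E] [CompleteSpace E] (A : E ≃L[ℂ] E) {T : E →L[ℂ] E}
    (h : ‖(A.symm : E →L[ℂ] E)‖ * ‖T - A‖ < 1) :
    ∃ B : E ≃L[ℂ] E, (B : E →L[ℂ] E) = T := by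
  have ht : ‖(A.symm : E →L[ℂ] E) * ((A : E →L[ℂ] E) - T)‖ < 1 :=
    (norm_mul_le _ _).trans_lt (by rwa [norm_sub_rev])
  refine ⟨(ContinuousLinearEquiv.unitsEquiv ℂ E (Units.oneSub _ ht)).trans A, ?_⟩
  ext x
  simp

/-- One approximate Newton step, controlled by the second-order data at the zero. -/
lemma norm_sub_inverse_apply_le {E : Type*} [NormedAddCommGroup E] [NormedSpace ℂ E]
    [CompleteSpace E] (A : E ≃L[ℂ] E) {T : E →L[ℂ] E} {d r : E} {L γ u : ℝ} (hL : 0 ≤ L)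
    (hγ : L * ‖(A.symm : E →L[ℂ] E)‖ ≤ γ) (hu0 : 0 ≤ u) (hu1 : u < 1)
    (hden : 0 < (1 + γ) * (1 - u) ^ 2 - γ)
    (hT : ‖T - A‖ ≤ L * (1 / (1 - u) ^ 2 - 1))
    (hr : ‖T d - r‖ ≤ L * ‖d‖ * (u / (1 - u) ^ 2)) :
    (∃ B : E ≃L[ℂ] E, (B : E →L[ℂ] E) = T) ∧
      ‖d - T.inverse r‖ ≤ γ * u / ((1 + γ) * (1 - u) ^ 2 - γ) * ‖d‖ := by
  have hq : 0 < (1 - u) ^ 2 := by nlinarith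
  have hc : 0 ≤ 1 / (1 - u) ^ 2 - 1 := by
    rw [sub_nonneg, le_div_iff₀ hq]
    nlinarith
  have hβ := norm_nonneg (A.symm : E →L[ℂ] E)
  have hγ0 : 0 ≤ γ := (by positivity : (0 : ℝ) ≤ _).trans hγ
  have hβT : ‖(A.symm : E →L[ℂ] E)‖ * ‖T - A‖ ≤ γ * (1 / (1 - u) ^ 2 - 1) := by
    calc _ ≤ ‖(A.symm : E →L[ℂ] E)‖ * (L * (1 / (1 - u) ^ 2 - 1)) := by gcongr
      _ = L * ‖(A.symm : E →L[ℂ] E)‖ * (1 / (1 - u) ^ 2 - 1) := by ring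
      _ ≤ _ := by gcongr
  have hlt : γ * (1 / (1 - u) ^ 2 - 1) < 1 := by
    have e : γ * (1 / (1 - u) ^ 2 - 1) = (γ - γ * (1 - u) ^ 2) / (1 - u) ^ 2 := by
      rw [sub_div, mul_div_assoc γ, div_self hq.ne']
      ring
    rw [e, div_lt_one hq]
    linarith
  obtain ⟨B, rfl⟩ := A.exists_eq_of_norm_symm_mul_lt (hβT.trans_lt hlt)
  refine ⟨⟨B, rfl⟩, ?_⟩
  rw [ContinuousLinearMap.inverse_equiv]
  set y := d - (B.symm : E →L[ℂ] E) r with hy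
  have hBy : B y = B d - r := by simp [hy]
  have hAy : y = A.symm ((B d - r) - ((B : E →L[ℂ] E) - A) y) := by
    rw [sub_apply, ContinuousLinearEquiv.coe_coe, ContinuousLinearEquiv.coe_coe, ← hBy]
    simp
  have h1 : ‖y‖ ≤ γ * ‖d‖ * (u / (1 - u) ^ 2) + γ * (1 / (1 - u) ^ 2 - 1) * ‖y‖ := by
    calc ‖y‖ = ‖(A.symm : E →L[ℂ] E) ((B d - r) - ((B : E →L[ℂ] E) - A) y)‖ := by
          conv_lhs => rw [hAy]
          rfl
      _ ≤ ‖(A.symm : E →L[ℂ] E)‖ * (‖B d - r‖ + ‖(B : E →L[ℂ] E) - A‖ * ‖y‖) := by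
        refine (ContinuousLinearMap.le_opNorm _ _).trans ?_
        gcongr
        exact (norm_sub_le _ _).trans (by gcongr; exact ContinuousLinearMap.le_opNorm _ _)
      _ ≤ ‖(A.symm : E →L[ℂ] E)‖ * (L * ‖d‖ * (u / (1 - u) ^ 2)) +
          ‖(A.symm : E →L[ℂ] E)‖ * ‖(B : E →L[ℂ] E) - A‖ * ‖y‖ := by
        rw [mul_add, ← mul_assoc _ _ ‖y‖]
        gcongr
        exact hr
      _ ≤ L * ‖(A.symm : E →L[ℂ] E)‖ * ‖d‖ * (u / (1 - u) ^ 2) +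
          γ * (1 / (1 - u) ^ 2 - 1) * ‖y‖ := by
        gcongr ?_ + ?_ * _
        exact le_of_eq (by ring)
      _ ≤ _ := by gcongr
  rw [div_mul_eq_mul_div, le_div_iff₀ hden]
  have h2 := mul_le_mul_of_nonneg_right h1 hq.le
  have e : (γ * ‖d‖ * (u / (1 - u) ^ 2) + γ * (1 / (1 - u) ^ 2 - 1) * ‖y‖) * (1 - u) ^ 2 =
      γ * u * ‖d‖ + γ * ‖y‖ - γ * ‖y‖ * (1 - u) ^ 2 := by
    have : 1 - u ≠ 0 := by linarith
    field_simp
    ring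
  rw [e] at h2
  linarith

lemma lt_one_and_two_mul_lt_of_lt_root {γ u : ℝ} (hγ : 1 ≤ γ)
    (hu : u < (2 * γ + 1 - Real.sqrt (4 * γ ^ 2 + 3 * γ)) / (γ + 1)) :
    u < 1 ∧ 2 * γ * u < (1 + γ) * (1 - u) ^ 2 - γ := by
  have hD0 := Real.sqrt_nonneg (4 * γ ^ 2 + 3 * γ)
  have hD := Real.sq_sqrt (show 0 ≤ 4 * γ ^ 2 + 3 * γ by positivity)
  set D := Real.sqrt (4 * γ ^ 2 + 3 * γ)
  rw [lt_div_iff₀ (by linarith)] at hu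
  have hDγ : γ ≤ D := by nlinarith
  refine ⟨by nlinarith, ?_⟩
  have h : D ^ 2 < (2 * γ + 1 - u * (γ + 1)) ^ 2 := by
    gcongr
    linarith
  rw [hD] at h
  have : 0 < (γ + 1) * ((1 + γ) * (1 - u) ^ 2 - γ - 2 * γ * u) := by nlinarith
  have := pos_of_mul_pos_right this (by linarith)
  linarith

/-- (γ-theorem)  Let `ζ ∈ B(ω,R)` be a zero of `f = (f₁,…,f_n) ∈ A²(ω,R)^n` with `Df(ζ)`
invertible; write `γ = γ(f,ζ)` and `κ = κ_ζ`.  Then for every `x ∈ B(ω,R)` with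
`u := κ‖x−ζ‖ < (2γ + 1 − √(4γ² + 3γ))/(γ + 1)`, the Newton sequence `x₀ = x`,
`x_{k+1} = N_f(x_k) = x_k − Df(x_k)⁻¹ f(x_k)` is well defined (`Df(x_k)` is invertible for
all `k`) and converges quadratically to `ζ`:  `‖x_k − ζ‖ ≤ (1/2)^{2^k−1}·‖x − ζ‖`. -/
theorem stmt12 (n : ℕ) (hn : 2 ≤ n) (ω : En n) (R : ℝ) (hR : 0 < R)
    (f : En n → En n) (hf : MemA2 ω R f)
    (ζ : En n) (hζ : ζ ∈ ball ω R) (hfζ : f ζ = 0)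
    (A : En n ≃L[ℂ] En n) (hA : (A : En n →L[ℂ] En n) = fderiv ℂ f ζ) :
    let ν : ℝ := ‖ζ - ω‖ / R
    let κ : ℝ := max 1 (((n : ℝ) + 1) / (R * (1 - ν ^ 2)))
    let lam : ℝ := A2Norm ω R f / (1 - ν ^ 2) ^ (((n : ℝ) + 1) / 2)
    let γ : ℝ := max 1 (lam * κ * ‖(A.symm : En n →L[ℂ] En n)‖)
    -- Newton operator, where `T.inverse` is the inverse of `T` when `T` is invertible
    let Nf : En n → En n := fun y => y - (fderiv ℂ f y).inverse (f y)
    ∀ x ∈ ball ω R,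
      κ * ‖x - ζ‖ < (2 * γ + 1 - Real.sqrt (4 * γ ^ 2 + 3 * γ)) / (γ + 1) →
      ∀ k : ℕ,
        (∃ B : En n ≃L[ℂ] En n, (B : En n →L[ℂ] En n) = fderiv ℂ f (Nf^[k] x)) ∧
        ‖Nf^[k] x - ζ‖ ≤ (1 / 2 : ℝ) ^ (2 ^ k - 1) * ‖x - ζ‖ := by
  intro ν κ lam γ Nf x _ hx k
  have hν0 : 0 ≤ ν := by positivity
  have hν1 : ν < 1 := (div_lt_one hR).2 (mem_ball_iff_norm.1 hζ)
  have ha : 0 < 1 - ν ^ 2 := by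
    have := pow_lt_one₀ hν0 hν1 two_ne_zero
    linarith
  have hκ1 : 1 ≤ κ := le_max_left _ _
  have hγ1 : 1 ≤ γ := le_max_left _ _
  have hs : 0 < (1 - ν ^ 2) ^ (((n : ℝ) + 1) / 2) := Real.rpow_pos_of_pos ha _
  have hs2 : ((1 - ν ^ 2) ^ (((n : ℝ) + 1) / 2)) ^ 2 = (1 - ν ^ 2) ^ (n + 1) := by
    rw [← Real.rpow_mul_natCast ha.le,
      show ((n : ℝ) + 1) / 2 * ((2 : ℕ) : ℝ) = ((n + 1 : ℕ) : ℝ) by push_cast; ring,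
      Real.rpow_natCast]
  have hlam : 0 ≤ lam := div_nonneg (a2Norm_nonneg _ _ _) hs.le
  obtain ⟨hu1, hu⟩ := lt_one_and_two_mul_lt_of_lt_root hγ1 hx
  set u : ℝ := κ * ‖x - ζ‖ with hudef
  have hu0 : 0 ≤ u := by positivity
  set δ : ℝ := (1 + γ) * (1 - u) ^ 2 - γ with hδ
  have hδ0 : 0 < δ := lt_of_le_of_lt (by positivity) hu
  have step : ∀ y : En n, ‖y - ζ‖ ≤ ‖x - ζ‖ →
      (∃ B : En n ≃L[ℂ] En n, (B : En n →L[ℂ] En n) = fderiv ℂ f y) ∧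
        ‖Nf y - ζ‖ ≤ γ * (κ * ‖y - ζ‖) / δ * ‖y - ζ‖ := by
    intro y hy
    have hw : κ * ‖y - ζ‖ ≤ u := by rw [hudef]; gcongr
    set w : ℝ := κ * ‖y - ζ‖ with hwdef
    have hw0 : 0 ≤ w := by positivity
    have hδw : δ ≤ (1 + γ) * (1 - w) ^ 2 - γ := by
      rw [hδ]
      gcongr
    have hM0 : 0 ≤ ((n : ℝ) + 1) / (R * (1 - ν ^ 2)) := by positivity
    have hMκ : ((n : ℝ) + 1) / (R * (1 - ν ^ 2)) ≤ κ := le_max_right _ _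
    obtain ⟨h1, h2⟩ := hf.norm_fderiv_estimates hn hR (x := y) hζ hfζ hs hs2 rfl rfl
      ((mul_le_mul_of_nonneg_right hMκ (norm_nonneg _)).trans_lt (hw.trans_lt hu1))
    set τ : ℝ := ((n : ℝ) + 1) / (R * (1 - ν ^ 2)) * ‖y - ζ‖
    have hτ0 : 0 ≤ τ := by positivity
    have hτw : τ ≤ w := mul_le_mul_of_nonneg_right hMκ (norm_nonneg _)
    have hw1 : 0 < 1 - w := by linarith
    have hq : (1 - w) ^ 2 ≤ (1 - τ) ^ 2 := by gcongr
    have hqi : 1 / (1 - τ) ^ 2 ≤ 1 / (1 - w) ^ 2 := by gcongr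
    have hq1 : 0 ≤ 1 / (1 - τ) ^ 2 - 1 := by
      rw [sub_nonneg, le_div_iff₀ (by nlinarith)]
      nlinarith
    obtain ⟨hB, hN⟩ := norm_sub_inverse_apply_le A (T := fderiv ℂ f y) (d := y - ζ) (r := f y)
      (L := lam * κ) (γ := γ) (u := w) (by positivity) (le_max_right _ _) hw0 (by linarith)
      (by linarith)
      (by
        rw [hA]
        refine h2.trans ?_
        change lam * _ * _ ≤ _
        gcongr)
      (by
        refine h1.trans ?_
        calc lam * (τ ^ 2 / (1 - τ) ^ 2) ≤ lam * (w ^ 2 / (1 - w) ^ 2) := by gcongr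
          _ = _ := by rw [sq w]; nth_rewrite 1 [hwdef]; ring)
    refine ⟨hB, ?_⟩
    have e : Nf y - ζ = y - ζ - (fderiv ℂ f y).inverse (f y) := by
      change y - _ - ζ = _
      abel
    rw [e]
    refine hN.trans ?_
    gcongr
  have hle : ∀ m : ℕ, (1 / 2 : ℝ) ^ m * ‖x - ζ‖ ≤ ‖x - ζ‖ := fun m =>
    mul_le_of_le_one_left (norm_nonneg _) (pow_le_one₀ (by norm_num) (by norm_num))
  have key : ∀ k : ℕ, ‖Nf^[k] x - ζ‖ ≤ (1 / 2 : ℝ) ^ (2 ^ k - 1) * ‖x - ζ‖ := by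
    intro k
    induction k with
    | zero => simp
    | succ k ih =>
      rw [Function.iterate_succ_apply']
      have hpow : 2 ^ (k + 1) - 1 = (2 ^ k - 1) + (2 ^ k - 1) + 1 := by
        have := Nat.one_le_two_pow (n := k)
        rw [pow_succ]
        omega
      have hhalf : γ * u / δ ≤ 1 / 2 := by
        rw [div_le_iff₀ hδ0]
        linarith
      calc _ ≤ γ * (κ * ‖Nf^[k] x - ζ‖) / δ * ‖Nf^[k] x - ζ‖ := (step _ (ih.trans (hle _))).2
        _ ≤ γ * (κ * ((1 / 2 : ℝ) ^ (2 ^ k - 1) * ‖x - ζ‖)) / δ *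
            ((1 / 2 : ℝ) ^ (2 ^ k - 1) * ‖x - ζ‖) := by gcongr
        _ = γ * u / δ * ((1 / 2 : ℝ) ^ ((2 ^ k - 1) + (2 ^ k - 1)) * ‖x - ζ‖) := by
          rw [hudef, pow_add]
          ring
        _ ≤ 1 / 2 * ((1 / 2 : ℝ) ^ ((2 ^ k - 1) + (2 ^ k - 1)) * ‖x - ζ‖) := by gcongr
        _ = _ := by rw [hpow, pow_succ]; ring
  exact ⟨(step _ ((key k).trans (hle _))).1, key k⟩
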